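/- arXiv:2506.18395 — 2 statements merged into one kernel-verified Lean document; each statement's English description precedes it below -/
import Mathlib

section
/- Assume the Riemann Hypothesis. Fix U ≥ 2, a weight W as described, a real number y > 0, complex numbers s₁, s₂ with 1 < Re(s₁) < 2, 1 < Re(s₂) < 2, s₁ ≠ s₂ and s₁ + s₂ ≠ 3, and a real number c₃′ with 3/4 ≤ c₃′ < min{1, 2 − Re(s₁), 2 − Re(s₂), 3 − Re(s₁+s₂)}. Then H(s₁, s₂; y) = ζ(s₁)ζ(s₂)ζ(s₁+s₂−1)/ζ(s₁+s₂) · y Ŵ(1) + ζ(2−s₂)ζ(1−s₂+s₁)ζ(s₁)/ζ(2+s₁−s₂) · y^{2−s₂} Ŵ(2−s₂) + ζ(2−s₁)ζ(1−s₁+s₂)ζ(s₂)/ζ(2+s₂−s₁) · y^{2−s₁} Ŵ(2−s₁) + ζ(3−s₁−s₂)ζ(2−s₁)ζ(2−s₂)/ζ(4−(s₁+s₂)) · y^{3−s₁−s₂} Ŵ(3−s₁−s₂) + (1/(2πi)) ∫_{Re s₃ = c₃′} ζ(s₃)ζ(s₃+s₁−1)ζ(s₃+s₂−1)ζ(s₃+s₁+s₂−2)/ζ(2s₃+s₁+s₂−2)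 · Ŵ(s₃) y^{s₃} ds₃. -/
open Complex Filter

/-- The Ramanujan sum `c_q(n) = ∑_{a mod q, gcd(a,q)=1} e(na/q)`. -/
noncomputable def ramanujanSum (q n : ℕ) : ℂ :=
  ∑ a ∈ (Finset.range q).filter (fun a => Nat.Coprime a q),
    Complex.exp (2 * Real.pi * Complex.I * (((n * a : ℕ) : ℂ) / (q : ℂ)))

/-- A smooth weight function attached to a parameter `U ≥ 2`: `0 ≤ W ≤ 1`, supported in
`[1/(2U), 1 + 1/(2U)]`, equal to `1` on `[1/U, 1]`, with `j`-th derivative `≪_j U^j`. -/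
structure Weight (U : ℝ) : Type where
  toFun : ℝ → ℝ
  smooth : ContDiff ℝ (⊤ : ℕ∞) toFun
  nonneg : ∀ t, 0 ≤ toFun t
  le_one : ∀ t, toFun t ≤ 1
  support_subset : ∀ t, t ∉ Set.Icc (1 / (2 * U)) (1 + 1 / (2 * U)) → toFun t = 0
  eq_one : ∀ t ∈ Set.Icc (1 / U) 1, toFun t = 1
  deriv_bound : ∀ j : ℕ, ∃ Cj : ℝ, ∀ t, |iteratedDeriv j toFun t| ≤ Cj * U ^ j

/-- The Mellin transform `Ŵ(s) = ∫_0^∞ W(t) t^{s-1} dt`. -/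
noncomputable def mellinW (W : ℝ → ℝ) (s : ℂ) : ℂ :=
  ∫ t in Set.Ioi (0 : ℝ), (W t : ℂ) * (t : ℂ) ^ (s - 1)

/-- `(1/(2πi)) ∫_{Re s = c} f(s) ds`, the normalized vertical line integral. -/
noncomputable def VI (c : ℝ) (f : ℂ → ℂ) : ℂ :=
  (1 / (2 * Real.pi * Complex.I)) * ∫ t : ℝ, f (c + t * Complex.I) * Complex.I

/-- The smoothed second moment `C(x,y) = ∑_n (∑_q c_q(n) W(q/x))² W(n/y)`. -/
noncomputable def Cxy {U : ℝ} (W : Weight U) (x y : ℝ) : ℂ :=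
  ∑' n : ℕ+, (∑' q : ℕ+, ramanujanSum q n * (W.toFun ((q : ℕ) / x) : ℂ)) ^ 2
    * (W.toFun ((n : ℕ) / y) : ℂ)

/-- The generalized divisor sum `σ_z(n) = ∑_{d ∣ n} d^z`. -/
noncomputable def sigmaC (z : ℂ) (n : ℕ) : ℂ := ∑ d ∈ n.divisors, (d : ℂ) ^ z

open MeasureTheory Topology Asymptotics

/-- The filter of points of the vertical strip `a ≤ Re s ≤ b` with `|Im s| → ∞`. -/
def vertStrip (a b : ℝ) : Filter ℂ :=
  comap (fun s : ℂ => |s.im|) atTop ⊓ 𝓟 {s | a ≤ s.re ∧ s.re ≤ b}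

lemma tendsto_vertLine_vertStrip {a b c : ℝ} (hac : a ≤ c) (hcb : c ≤ b) :
    Tendsto (fun t : ℝ => (c + t * I : ℂ)) (cocompact ℝ) (vertStrip a b) := by
  refine tendsto_inf.2 ⟨tendsto_comap_iff.2 ?_, tendsto_principal.2 (Eventually.of_forall ?_)⟩
  · exact (tendsto_norm_cocompact_atTop (E := ℝ)).congr fun t => by simp
  · intro t
    simpa using ⟨hac, hcb⟩

lemma eventually_vertStrip_iff {a b : ℝ} {p : ℂ → Prop} :
    (∀ᶠ s in vertStrip a b, p s) ↔
      ∃ T : ℝ, ∀ s : ℂ, a ≤ s.re → s.re ≤ b → T ≤ |s.im| → p s := by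
  rw [vertStrip, eventually_inf_principal, eventually_comap]
  constructor
  · intro h
    obtain ⟨T, hT⟩ := eventually_atTop.1 h
    exact ⟨T, fun s h1 h2 h3 => hT _ h3 s rfl ⟨h1, h2⟩⟩
  · rintro ⟨T, hT⟩
    filter_upwards [eventually_ge_atTop T] with x hx s hs h
    exact hT s h.1 h.2 (hs ▸ hx)

lemma integrable_vertLine {a b c : ℝ} (hac : a ≤ c) (hcb : c ≤ b) {f : ℂ → ℂ}
    (hf : ∀ s : ℂ, s.re = c → ContinuousAt f s)
    (hd : f =O[vertStrip a b] fun s => (1 + s.im ^ 2)⁻¹) :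
    Integrable fun t : ℝ => f (c + t * I) := by
  have hc : Continuous fun t : ℝ => f (c + t * I) := by
    refine continuous_iff_continuousAt.2 fun t => ?_
    refine ContinuousAt.comp (f := fun t : ℝ => (c + t * I : ℂ)) (hf _ (by simp)) (by fun_prop)
  refine hc.locallyIntegrable.integrable_of_isBigO_cocompact
    (g := fun t : ℝ => (1 + t ^ 2)⁻¹) ?_ (integrable_inv_one_add_sq.integrableAtFilter _)
  simpa [Function.comp_def] using hd.comp_tendsto (tendsto_vertLine_vertStrip hac hcb)

/-- The integrals of a holomorphic function along the two edges of a vertical strip agree if the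
function decays quadratically. -/
lemma integral_vertLine_eq {a b : ℝ} (hab : a ≤ b) {f : ℂ → ℂ}
    (hf : ∀ s : ℂ, a ≤ s.re → s.re ≤ b → DifferentiableAt ℂ f s)
    (hd : f =O[vertStrip a b] fun s => (1 + s.im ^ 2)⁻¹) :
    ∫ t : ℝ, f (b + t * I) = ∫ t : ℝ, f (a + t * I) := by
  have hrect (T : ℝ) := integral_boundary_rect_eq_zero_of_differentiableOn f
    (⟨a, -T⟩ : ℂ) (⟨b, T⟩ : ℂ) fun s hs => by
      rw [mem_reProdIm, Set.uIcc_of_le hab] at hs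
      exact (hf s hs.1.1 hs.1.2).differentiableWithinAt
  have hlim {c : ℝ} (hac : a ≤ c) (hcb : c ≤ b) :
      Tendsto (fun T : ℝ => ∫ t in (-T)..T, f (c + t * I)) atTop
        (𝓝 (∫ t : ℝ, f (c + t * I))) :=
    intervalIntegral_tendsto_integral
      (integrable_vertLine hac hcb
        (fun s hs => (hf s (hs ▸ hac) (hs ▸ hcb)).continuousAt) hd)
      tendsto_neg_atTop_atBot tendsto_id
  obtain ⟨C, hC⟩ := hd.bound
  obtain ⟨T₀, hT₀⟩ := eventually_vertStrip_iff.1 hC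
  have hz : Tendsto (fun T : ℝ => C * (1 + T ^ 2)⁻¹ * |b - a|) atTop (𝓝 0) := by
    have h1 : Tendsto (fun T : ℝ => 1 + T ^ 2) atTop atTop :=
      tendsto_atTop_add_const_left _ _ (tendsto_pow_atTop two_ne_zero)
    simpa using (h1.inv_tendsto_atTop.const_mul C).mul_const |b - a|
  have hbound {e : ℝ → ℝ} (he : ∀ T, |e T| = |T|) :
      Tendsto (fun T : ℝ => ∫ x in a..b, f (x + e T * I)) atTop (𝓝 0) := by
    refine squeeze_zero_norm' ?_ hz
    filter_upwards [eventually_ge_atTop T₀, eventually_ge_atTop 0] with T hT hT'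
    refine intervalIntegral.norm_integral_le_of_norm_le_const fun x hx => ?_
    rw [Set.uIoc_of_le hab] at hx
    have h2 : e T ^ 2 = T ^ 2 := by rw [← sq_abs, he, sq_abs]
    have := hT₀ (x + e T * I) (by simpa using hx.1.le) (by simpa using hx.2)
      (by simpa [he] using hT.trans (le_abs_self T))
    simpa [h2, abs_of_pos (by positivity : 0 < 1 + T ^ 2)] using this
  have hneg := hbound (e := fun T => -T) (by simp)
  have hpos := hbound (e := fun T => T) (by simp)
  have hall := ((hneg.sub hpos).add ((hlim hab le_rfl).const_mul I)).sub
    ((hlim le_rfl hab).const_mul I)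
  have h0 := tendsto_nhds_unique hall (tendsto_const_nhds (x := (0 : ℂ)) |>.congr fun T => by
    simpa using (hrect T).symm)
  have : I * ((∫ t : ℝ, f (b + t * I)) - ∫ t : ℝ, f (a + t * I)) = 0 := by
    linear_combination h0
  exact sub_eq_zero.1 ((mul_eq_zero.1 this).resolve_left I_ne_zero)

lemma integral_re_inv_add_mul_I {A : ℝ} (hA : A ≠ 0) :
    Integrable (fun u : ℝ => A / (A ^ 2 + u ^ 2)) ∧
      ∫ u : ℝ, A / (A ^ 2 + u ^ 2) = Real.pi * SignType.sign A := by
  have h : (fun u : ℝ => A / (A ^ 2 + u ^ 2)) = fun u => A⁻¹ * (1 + (u / A) ^ 2)⁻¹ := by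
    ext u
    have : 0 < A ^ 2 + u ^ 2 := by positivity
    field_simp
  rw [h]
  refine ⟨(integrable_inv_one_add_sq.comp_div hA).const_mul _, ?_⟩
  rw [integral_const_mul, Measure.integral_comp_div (fun x => (1 + x ^ 2)⁻¹),
    integral_univ_inv_one_add_sq, smul_eq_mul]
  rcases hA.lt_or_gt with h | h
  · rw [abs_of_neg h, sign_neg h]
    simp
    field_simp
  · rw [abs_of_pos h, sign_pos h]
    simp
    field_simp

lemma one_div_add_mul_I_add_one_div {A : ℝ} (hA : A ≠ 0) (u : ℝ) :
    1 / (A + u * I) + 1 / (A + (-u : ℝ) * I) = ((2 * (A / (A ^ 2 + u ^ 2)) : ℝ) : ℂ) := by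
  have h1 : (A + u * I : ℂ) ≠ 0 := fun h => hA (by simpa using congrArg re h)
  have h2 : (A - u * I : ℂ) ≠ 0 := fun h => hA (by simpa using congrArg re h)
  have h4 : (A ^ 2 + u ^ 2 : ℂ) = (A + u * I) * (A - u * I) := by
    linear_combination (u : ℂ) ^ 2 * I_sq
  push_cast
  rw [h4, neg_mul, ← sub_eq_add_neg]
  field_simp
  ring

lemma one_sub_div_isBigO (a b : ℝ) (p q : ℂ) :
    (fun s : ℂ => 1 / (s - p) - 1 / (s - q)) =O[vertStrip a b] fun s => (1 + s.im ^ 2)⁻¹ := by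
  refine IsBigO.of_bound (‖p - q‖ * 8) (eventually_vertStrip_iff.2
    ⟨2 * |p.im| + 2 * |q.im| + 1, fun s _ _ hs => ?_⟩)
  have key (w : ℂ) (hw : 2 * |w.im| + 1 ≤ |s.im|) : |s.im| / 2 ≤ ‖s - w‖ := by
    have h1 := abs_im_le_norm (s - w)
    have h2 := abs_sub_abs_le_abs_sub s.im w.im
    rw [sub_im] at h1
    linarith [abs_nonneg w.im]
  have hp := key p (by linarith [abs_nonneg q.im])
  have hq := key q (by linarith [abs_nonneg p.im])
  have h1 : 1 ≤ |s.im| := by linarith [abs_nonneg q.im, abs_nonneg p.im]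
  have hp0 : s - p ≠ 0 := norm_pos_iff.1 (by linarith)
  have hq0 : s - q ≠ 0 := norm_pos_iff.1 (by linarith)
  have : 1 / (s - p) - 1 / (s - q) = (p - q) * ((s - p) * (s - q))⁻¹ := by
    field_simp
    ring
  rw [this, norm_mul, norm_inv, norm_mul, mul_assoc]
  refine mul_le_mul_of_nonneg_left ?_ (norm_nonneg _)
  rw [Real.norm_eq_abs, abs_of_pos (by positivity), ← sq_abs, ← div_eq_mul_inv]
  rw [inv_eq_one_div, div_le_div_iff₀ (by nlinarith) (by positivity)]
  nlinarith [mul_le_mul hp hq (by positivity) (by positivity)]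

/-- The vertical line integral of a difference of two Cauchy kernels at the same height. -/
lemma VI_one_sub_div {c : ℝ} {p q : ℂ} (hp : p.re ≠ c) (hq : q.re ≠ c) (him : p.im = q.im) :
    VI c (fun s => 1 / (s - p) - 1 / (s - q)) =
      ((SignType.sign (c - p.re) : ℝ) - (SignType.sign (c - q.re) : ℝ)) / 2 := by
  set A := c - p.re with hA
  set B := c - q.re with hB
  have hA0 : A ≠ 0 := sub_ne_zero.2 hp.symm
  have hB0 : B ≠ 0 := sub_ne_zero.2 hq.symm
  set g : ℝ → ℂ := fun u => 1 / (A + u * I) - 1 / (B + u * I) with hg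
  have hshift : ∫ t : ℝ, (1 / ((c + t * I : ℂ) - p) - 1 / ((c + t * I : ℂ) - q)) * I =
      (∫ u, g u) * I := by
    rw [integral_mul_const, ← integral_add_right_eq_self _ p.im]
    congr 2
    ext u
    simp only [hg]
    congr 2
    · apply Complex.ext <;> simp [hA]
    · apply Complex.ext <;> simp [hB, him]
  have hgint : Integrable g := by
    have := (integrable_vertLine (a := c) (b := c) le_rfl le_rfl (fun s hs => ?_)
      (one_sub_div_isBigO c c p q)).comp_add_right p.im
    · refine this.congr (Eventually.of_forall fun u => ?_)
      simp only [hg]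
      congr 2
      · apply Complex.ext <;> simp [hA]
      · apply Complex.ext <;> simp [hB, him]
    · have hp0 : s - p ≠ 0 := fun h => hp (by rw [← hs, sub_eq_zero.1 h])
      have hq0 : s - q ≠ 0 := fun h => hq (by rw [← hs, sub_eq_zero.1 h])
      fun_prop (disch := assumption)
  have hval : ∫ u, g u =
      ((Real.pi * SignType.sign A - Real.pi * SignType.sign B : ℝ) : ℂ) := by
    have h1 : (∫ u, g u) + ∫ u, g u = ∫ u, (g u + g (-u)) := by
      rw [integral_add hgint hgint.comp_neg, integral_neg_eq_self]
    have h2 : ∫ u, (g u + g (-u)) =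
        ∫ u, ((2 * (A / (A ^ 2 + u ^ 2) - B / (B ^ 2 + u ^ 2)) : ℝ) : ℂ) := by
      congr 1
      ext u
      have hA1 := one_div_add_mul_I_add_one_div hA0 u
      have hB1 := one_div_add_mul_I_add_one_div hB0 u
      simp only [hg]
      push_cast at hA1 hB1 ⊢
      linear_combination hA1 - hB1
    rw [integral_complex_ofReal, integral_const_mul,
      integral_sub (integral_re_inv_add_mul_I hA0).1 (integral_re_inv_add_mul_I hB0).1,
      (integral_re_inv_add_mul_I hA0).2, (integral_re_inv_add_mul_I hB0).2] at h2
    rw [h2] at h1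
    push_cast at *
    linear_combination h1 / 2
  rw [VI, hshift, hval]
  have : (Real.pi : ℂ) ≠ 0 := by exact_mod_cast Real.pi_ne_zero
  push_cast
  field_simp

/-- Subtracting a pole: a function with a simple pole at `p` becomes differentiable at `p` after
removal of its principal part and redefinition at `p`. -/
lemma exists_differentiableAt_of_simplePole {f : ℂ → ℂ} {p q r : ℂ} (hpq : p ≠ q)
    (hf : ∀ᶠ s in 𝓝[≠] p, DifferentiableAt ℂ f s)
    (hr : Tendsto (fun s => (s - p) * f s) (𝓝[≠] p) (𝓝 r)) :
    ∃ v : ℂ, DifferentiableAt ℂ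
      (Function.update (fun s => f s - r * (1 / (s - p) - 1 / (s - q))) p v) p := by
  set G : ℂ → ℂ := fun s => f s - r * (1 / (s - p) - 1 / (s - q)) with hG
  refine ⟨limUnder (𝓝[≠] p) G, ?_⟩
  have hq : ∀ᶠ s in 𝓝[≠] p, s ≠ q := (eventually_ne_nhds hpq).filter_mono nhdsWithin_le_nhds
  have hp : ∀ᶠ s in 𝓝[≠] p, s ≠ p := eventually_mem_nhdsWithin
  have hGd : ∀ᶠ s in 𝓝[≠] p, DifferentiableAt ℂ G s := by
    filter_upwards [hf, hq, hp] with s h1 h2 h3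
    have h2' := sub_ne_zero.2 h2
    have h3' := sub_ne_zero.2 h3
    fun_prop (disch := assumption)
  have ho : (fun s => G s - G p) =o[𝓝[≠] p] fun s => (s - p)⁻¹ := by
    rw [isLittleO_iff_tendsto' (by
      filter_upwards [hp] with s hs h
      exact absurd h (inv_ne_zero (sub_ne_zero.2 hs)))]
    have hid : Tendsto (fun s : ℂ => s - p) (𝓝[≠] p) (𝓝 0) := by
      have : Tendsto (fun s : ℂ => s - p) (𝓝 p) (𝓝 (p - p)) :=
        (continuous_id.sub continuous_const).tendsto p
      rw [sub_self] at this
      exact this.mono_left nhdsWithin_le_nhds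
    have hinv : Tendsto (fun s : ℂ => (s - q)⁻¹) (𝓝[≠] p) (𝓝 (p - q)⁻¹) :=
      (((continuous_id.sub continuous_const).tendsto p).inv₀
        (sub_ne_zero.2 hpq)).mono_left nhdsWithin_le_nhds
    have hlim := ((hr.sub (tendsto_const_nhds (x := r))).add
      ((hid.mul hinv).const_mul r)).sub (hid.mul_const (G p))
    simp only [sub_self, zero_mul, mul_zero, add_zero] at hlim
    refine hlim.congr' ?_
    filter_upwards [hp] with s hs
    have := sub_ne_zero.2 hs
    simp only [hG]
    field_simp
    ring
  have := differentiableOn_update_limUnder_insert_of_isLittleO (s := {s | DifferentiableAt ℂ G s})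
    hGd (fun s hs => DifferentiableAt.differentiableWithinAt hs) ho
  exact this.differentiableAt (insert_mem_nhds_iff.2 hGd)

lemma VI_sub_const_mul {c : ℝ} {f g : ℂ → ℂ} (r : ℂ)
    (hf : Integrable fun t : ℝ => f (c + t * I)) (hg : Integrable fun t : ℝ => g (c + t * I)) :
    VI c (fun s => f s - r * g s) = VI c f - r * VI c g := by
  simp only [VI, integral_mul_const]
  rw [integral_sub hf (hg.const_mul r), integral_const_mul]
  ring

/-- Shifting a vertical line of integration past finitely many simple poles. -/
theorem VI_eq_sum_residues_add {a b : ℝ} (hab : a < b) (S : Finset ℂ) :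
    ∀ (f : ℂ → ℂ) (r : ℂ → ℂ), (∀ p ∈ S, a < p.re ∧ p.re < b) →
    (∀ s : ℂ, a ≤ s.re → s.re ≤ b → s ∉ S → DifferentiableAt ℂ f s) →
    (∀ p ∈ S, Tendsto (fun s => (s - p) * f s) (𝓝[≠] p) (𝓝 (r p))) →
    (f =O[vertStrip a b] fun s => (1 + s.im ^ 2)⁻¹) →
    VI b f = ∑ p ∈ S, r p + VI a f := by
  induction S using Finset.induction_on with
  | empty =>
    intro f r _ hf _ hd
    simp only [VI, integral_mul_const, Finset.sum_empty, zero_add]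
    rw [integral_vertLine_eq hab.le (fun s h1 h2 => hf s h1 h2 (Finset.notMem_empty s)) hd]
  | insert p S hp ih =>
    intro f r hS hf hr hd
    obtain ⟨hap, hpb⟩ := hS p (Finset.mem_insert_self p S)
    set q : ℂ := p - ((p.re - a + 1 : ℝ) : ℂ) with hq
    have hqre : q.re = a - 1 := by
      simp only [hq, sub_re, ofReal_re]
      ring
    have hqim : p.im = q.im := by simp [hq]
    have hpq : p ≠ q := fun h => by
      have := congrArg re h
      rw [hqre] at this
      linarith
    set K : ℂ → ℂ := fun s => 1 / (s - p) - 1 / (s - q) with hK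
    have hKd (s : ℂ) (h1 : a ≤ s.re) (h2 : s ≠ p) : DifferentiableAt ℂ K s := by
      have h2' := sub_ne_zero.2 h2
      have h3' : s - q ≠ 0 := sub_ne_zero.2 fun h => by
        rw [h, hqre] at h1
        linarith
      fun_prop (disch := assumption)
    have hopen : ∀ᶠ s in 𝓝 p, a < s.re ∧ s.re < b :=
      (continuous_re.continuousAt.eventually_const_lt hap).and
        (continuous_re.continuousAt.eventually_lt_const hpb)
    have hfp : ∀ᶠ s in 𝓝[≠] p, DifferentiableAt ℂ f s := by
      have h2 : ∀ᶠ s in 𝓝 p, s ∉ S :=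
        S.finite_toSet.isClosed.isOpen_compl.mem_nhds (by simpa using hp)
      filter_upwards [hopen.filter_mono nhdsWithin_le_nhds, h2.filter_mono nhdsWithin_le_nhds,
        eventually_mem_nhdsWithin] with s hs1 hs2 hs3
      exact hf s hs1.1.le hs1.2.le (by simpa [hs2] using hs3)
    obtain ⟨v, hv⟩ := exists_differentiableAt_of_simplePole hpq hfp
      (hr p (Finset.mem_insert_self p S))
    set G : ℂ → ℂ := fun s => f s - r p * K s with hG
    set F : ℂ → ℂ := Function.update G p v with hF
    have hFG (s : ℂ) (hs : s ≠ p) : F =ᶠ[𝓝 s] G := by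
      filter_upwards [eventually_ne_nhds hs] with z hz
      exact Function.update_of_ne hz _ _
    have hFline {c : ℝ} (hc : p.re ≠ c) : VI c F = VI c G := by
      simp only [VI]
      congr 2
      ext t
      rw [(hFG _ fun h => hc (by simp [← h])).eq_of_nhds]
    have hdG : G =O[vertStrip a b] fun s => (1 + s.im ^ 2)⁻¹ :=
      hd.sub ((one_sub_div_isBigO a b p q).const_mul_left (r p))
    have hdF : F =O[vertStrip a b] fun s => (1 + s.im ^ 2)⁻¹ := by
      refine hdG.congr' ?_ EventuallyEq.rfl
      refine eventually_vertStrip_iff.2 ⟨|p.im| + 1, fun s _ _ hs => ?_⟩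
      refine (hFG s fun h => ?_).eq_of_nhds.symm
      rw [h] at hs
      linarith
    have hmain := ih F r (fun p' hp' => hS p' (Finset.mem_insert_of_mem hp'))
      (fun s h1 h2 h3 => ?_) (fun p' hp' => ?_) hdF
    · have hline {c : ℝ} (hac : a ≤ c) (hcb : c ≤ b) (hc : ∀ x ∈ insert p S, x.re ≠ c) :
          VI c F = VI c f - r p * VI c K := by
        rw [hFline (hc p (Finset.mem_insert_self p S)), hG]
        refine VI_sub_const_mul _ (integrable_vertLine hac hcb (fun s hs => ?_) hd)
          (integrable_vertLine hac hcb (fun s hs => ?_) (one_sub_div_isBigO a b p q))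
        · exact (hf s (hs ▸ hac) (hs ▸ hcb) fun h => hc s h hs).continuousAt
        · refine (hKd s (hs ▸ hac) fun h => ?_).continuousAt
          exact hc p (Finset.mem_insert_self p S) (h ▸ hs)
      rw [hline hab.le le_rfl fun p' hp' => (hS p' hp').2.ne,
        hline le_rfl hab.le fun p' hp' => (hS p' hp').1.ne', hK,
        VI_one_sub_div hpb.ne (by linarith) hqim,
        VI_one_sub_div hap.ne' (by linarith) hqim, sign_pos (by linarith : 0 < b - p.re),
        sign_pos (by linarith : 0 < b - q.re), sign_neg (by linarith : a - p.re < 0),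
        sign_pos (by linarith : 0 < a - q.re)] at hmain
      rw [Finset.sum_insert hp]
      simp only [SignType.coe_neg_one, SignType.coe_one] at hmain
      push_cast at hmain
      linear_combination hmain
    · rcases eq_or_ne s p with rfl | hs
      · exact hv
      · refine DifferentiableAt.congr_of_eventuallyEq ?_ (hFG s hs)
        exact (hf s h1 h2 (by simp [hs, h3])).sub ((hKd s h1 hs).const_mul _)
    · have hne : p' ≠ p := fun h => hp (h ▸ hp')
      have h1 := hr p' (Finset.mem_insert_of_mem hp')
      have h2 : Tendsto (fun s => (s - p') * (r p * K s)) (𝓝[≠] p') (𝓝 0) := by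
        have hc : ContinuousAt (fun s => (s - p') * (r p * K s)) p' := by
          have := (hKd p' (hS p' (Finset.mem_insert_of_mem hp')).1.le hne).continuousAt
          fun_prop
        simpa [ContinuousAt] using hc.mono_left nhdsWithin_le_nhds
      have h3 := h1.sub h2
      rw [sub_zero] at h3
      refine h3.congr' ?_
      filter_upwards [(hFG p' hne).filter_mono nhdsWithin_le_nhds] with s hs
      rw [hs, hG]
      ring

lemma mellinW_eq_mellin (W : ℝ → ℝ) : mellinW W = mellin fun t => (W t : ℂ) := by
  ext s
  simp only [mellinW, mellin, smul_eq_mul, mul_comm]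

section CompactSupportMellin

variable {α β : ℝ} {V : ℝ → ℂ}

lemma isBigO_atTop_of_eq_zero (hV : ∀ t ∉ Set.Icc α β, V t = 0) (g : ℝ → ℝ) :
    V =O[atTop] g := by
  refine (isBigO_zero g atTop).congr' ?_ EventuallyEq.rfl
  filter_upwards [eventually_gt_atTop β] with t ht
  exact (hV t fun h => absurd h.2 ht.not_ge).symm

lemma isBigO_nhdsWithin_zero_of_eq_zero (hα : 0 < α) (hV : ∀ t ∉ Set.Icc α β, V t = 0)
    (g : ℝ → ℝ) : V =O[𝓝[>] 0] g := by
  refine (isBigO_zero g _).congr' ?_ EventuallyEq.rfl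
  filter_upwards [(eventually_lt_nhds hα).filter_mono nhdsWithin_le_nhds] with t ht
  exact (hV t fun h => absurd h.1 ht.not_ge).symm

lemma mellinConvergent_of_eq_zero (hα : 0 < α) (hc : Continuous V)
    (hV : ∀ t ∉ Set.Icc α β, V t = 0) (s : ℂ) : MellinConvergent V s :=
  mellinConvergent_of_isBigO_rpow (a := s.re + 1) (b := s.re - 1)
    (hc.locallyIntegrable.locallyIntegrableOn _)
    (isBigO_atTop_of_eq_zero hV _) (by linarith)
    (isBigO_nhdsWithin_zero_of_eq_zero hα hV _) (by linarith)

lemma differentiable_mellin_of_eq_zero (hα : 0 < α) (hc : Continuous V)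
    (hV : ∀ t ∉ Set.Icc α β, V t = 0) : Differentiable ℂ (mellin V) := fun s =>
  mellin_differentiableAt_of_isBigO_rpow (a := s.re + 1) (b := s.re - 1)
    (hc.locallyIntegrable.locallyIntegrableOn _)
    (isBigO_atTop_of_eq_zero hV _) (by linarith)
    (isBigO_nhdsWithin_zero_of_eq_zero hα hV _) (by linarith)

lemma deriv_eq_zero_of_eq_zero (hV : ∀ t ∉ Set.Icc α β, V t = 0) :
    ∀ t ∉ Set.Icc α β, deriv V t = 0 := by
  intro t ht
  have : V =ᶠ[𝓝 t] fun _ => 0 := by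
    filter_upwards [isClosed_Icc.isOpen_compl.mem_nhds ht] with x hx
    exact hV x hx
  rw [this.deriv_eq, deriv_const]

/-- Integration by parts for the Mellin transform. -/
lemma mul_mellin_eq_mellin_deriv (hα : 0 < α) (hd : ContDiff ℝ 1 V)
    (hV : ∀ t ∉ Set.Icc α β, V t = 0) (s : ℂ) :
    s * mellin V s = mellin (fun t => -(t : ℂ) * deriv V t) s := by
  have hc' : Continuous (deriv V) := hd.continuous_deriv le_rfl
  have hV' := deriv_eq_zero_of_eq_zero hV
  have h1 : MellinConvergent V s := mellinConvergent_of_eq_zero hα hd.continuous hV s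
  have h2 : MellinConvergent (fun t => -(t : ℂ) * deriv V t) s :=
    mellinConvergent_of_eq_zero (β := β) hα (by fun_prop) (fun t ht => by simp [hV' t ht]) s
  have h1' := (h1.const_mul s)
  have hder : ∀ t ∈ Set.Ioi (0 : ℝ), HasDerivAt (fun t : ℝ => (t : ℂ) ^ s * V t)
      (s * ((t : ℂ) ^ (s - 1) • V t) - (t : ℂ) ^ (s - 1) • (-(t : ℂ) * deriv V t)) t := by
    intro t ht
    have ht0 : (t : ℂ) ≠ 0 := by exact_mod_cast (ne_of_gt ht : t ≠ 0)
    have hp : HasDerivAt (fun t : ℝ => (t : ℂ) ^ s) (s * (t : ℂ) ^ (s - 1)) t := by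
      have := (hasDerivAt_id (t : ℂ)).cpow_const (c := s)
        (Or.inl (by simpa using ht))
      simpa using this.comp_ofReal
    have hv : HasDerivAt V (deriv V t) t :=
      (hd.differentiable one_ne_zero).differentiableAt.hasDerivAt
    refine (hp.mul hv).congr_deriv ?_
    have : (t : ℂ) ^ s = (t : ℂ) ^ (s - 1) * t := by
      rw [cpow_sub _ _ ht0, cpow_one]
      field_simp
    rw [this, smul_eq_mul, smul_eq_mul]
    ring
  have hzero : ∀ᶠ t : ℝ in 𝓝 0, (t : ℂ) ^ s * V t = 0 := by
    filter_upwards [eventually_lt_nhds hα] with t ht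
    rw [hV t fun h => absurd h.1 ht.not_ge, mul_zero]
  have hcont : ContinuousWithinAt (fun t : ℝ => (t : ℂ) ^ s * V t) (Set.Ici 0) 0 := by
    have : (fun t : ℝ => (t : ℂ) ^ s * V t) =ᶠ[𝓝 0] fun _ => 0 := hzero
    exact (continuousAt_const.congr this.symm).continuousWithinAt
  have hlim : Tendsto (fun t : ℝ => (t : ℂ) ^ s * V t) atTop (𝓝 0) := by
    refine tendsto_const_nhds.congr' ?_
    filter_upwards [eventually_gt_atTop β] with t ht
    rw [hV t fun h => absurd h.2 ht.not_ge, mul_zero]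
  have hmain := integral_Ioi_of_hasDerivAt_of_tendsto hcont hder
    (Integrable.sub h1' h2) hlim
  rw [integral_sub h1' h2, integral_const_mul, hzero.self_of_nhds, sub_zero] at hmain
  exact sub_eq_zero.1 hmain

lemma rpow_le_rpow_add_rpow {x a b c : ℝ} (hx : 0 < x) (hac : a ≤ c) (hcb : c ≤ b) :
    x ^ c ≤ x ^ a + x ^ b := by
  rcases le_total x 1 with h | h
  · linarith [Real.rpow_le_rpow_of_exponent_ge hx h hac, Real.rpow_nonneg hx.le b]
  · linarith [Real.rpow_le_rpow_of_exponent_le h hcb, Real.rpow_nonneg hx.le a]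

lemma norm_mellin_le (hα : 0 < α) (hc : Continuous V) (hV : ∀ t ∉ Set.Icc α β, V t = 0)
    (a b : ℝ) : ∃ C : ℝ, ∀ s : ℂ, a ≤ s.re → s.re ≤ b → ‖mellin V s‖ ≤ C := by
  have ha := (mellinConvergent_of_eq_zero hα hc hV a).norm
  have hb := (mellinConvergent_of_eq_zero hα hc hV b).norm
  refine ⟨_, fun s h1 h2 => norm_integral_le_of_norm_le (ha.add hb) ?_⟩
  refine (ae_restrict_iff' measurableSet_Ioi).2 (Eventually.of_forall fun t ht => ?_)
  simp only [norm_smul, Pi.add_apply, norm_cpow_eq_rpow_re_of_pos ht, sub_re, ofReal_re, one_re]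
  rw [← add_mul]
  exact mul_le_mul_of_nonneg_right
    (rpow_le_rpow_add_rpow ht (by linarith) (by linarith)) (norm_nonneg _)

/-- The Mellin transform of a smooth function with compact support in `(0, ∞)` decays faster than
any power, uniformly in vertical strips. -/
lemma norm_pow_mul_mellin_le (hα : 0 < α) (hd : ContDiff ℝ (⊤ : ℕ∞) V)
    (hV : ∀ t ∉ Set.Icc α β, V t = 0) (a b : ℝ) (k : ℕ) :
    ∃ C : ℝ, ∀ s : ℂ, a ≤ s.re → s.re ≤ b → ‖s‖ ^ k * ‖mellin V s‖ ≤ C := by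
  induction k generalizing V with
  | zero => simpa using norm_mellin_le hα hd.continuous hV a b
  | succ k ih =>
    have hd' : ContDiff ℝ (⊤ : ℕ∞) (deriv V) := (contDiff_infty_iff_deriv.1 hd).2
    obtain ⟨C, hC⟩ := ih (V := fun t => -(t : ℂ) * deriv V t)
      (ofRealCLM.contDiff.neg.mul hd')
      (fun t ht => by simp [deriv_eq_zero_of_eq_zero hV t ht])
    refine ⟨C, fun s h1 h2 => ?_⟩
    rw [pow_succ, mul_assoc, ← norm_mul,
      mul_mellin_eq_mellin_deriv hα (hd.of_le (by exact_mod_cast le_top)) hV]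
    exact hC s h1 h2

end CompactSupportMellin

/-- The fractional part, cut off to `(1, ∞)`. -/
noncomputable def fractIoi (t : ℝ) : ℂ := (Set.Ioi (1 : ℝ)).indicator (fun t => ((Int.fract t : ℝ) : ℂ)) t

lemma norm_fractIoi_le_one (t : ℝ) : ‖fractIoi t‖ ≤ 1 := by
  refine (norm_indicator_le_norm_self _ _).trans ?_
  rw [norm_real, Real.norm_eq_abs, Int.abs_fract]
  exact (Int.fract_lt_one t).le

lemma measurable_fractIoi : Measurable fractIoi :=
  Measurable.indicator (f := fun t : ℝ => ((Int.fract t : ℝ) : ℂ))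
    (measurable_ofReal.comp measurable_fract) measurableSet_Ioi

lemma locallyIntegrable_fractIoi : LocallyIntegrable fractIoi :=
  (locallyIntegrable_const (1 : ℝ)).mono measurable_fractIoi.aestronglyMeasurable
    (Eventually.of_forall fun t => by simpa using norm_fractIoi_le_one t)

lemma differentiableAt_mellin_fractIoi {s : ℂ} (hs : s.re < 0) :
    DifferentiableAt ℂ (mellin fractIoi) s := by
  refine mellin_differentiableAt_of_isBigO_rpow (a := 0) (b := s.re - 1)
    (locallyIntegrable_fractIoi.locallyIntegrableOn _) ?_ hs ?_ (by linarith)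
  · exact IsBigO.of_bound 1 (Eventually.of_forall fun t => by
      simpa using norm_fractIoi_le_one t)
  · refine (isBigO_zero _ _).congr' ?_ EventuallyEq.rfl
    filter_upwards [(eventually_lt_nhds (zero_lt_one' ℝ)).filter_mono nhdsWithin_le_nhds] with t ht
    exact (Set.indicator_of_notMem (fun h => absurd h (not_lt.2 ht.le)) _).symm

lemma mellin_fractIoi_eq (s : ℂ) :
    mellin fractIoi (-s) = ∫ t in Set.Ioi (1 : ℝ), ((Int.fract t : ℝ) : ℂ) * (t : ℂ) ^ (-(s + 1)) := by
  rw [mellin, ← integral_indicator measurableSet_Ioi, ← integral_indicator measurableSet_Ioi]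
  congr 1
  ext t
  by_cases h1 : t ∈ Set.Ioi (1 : ℝ)
  · have h0 : t ∈ Set.Ioi (0 : ℝ) := Set.mem_Ioi.2 (zero_lt_one.trans h1)
    rw [Set.indicator_of_mem h0, Set.indicator_of_mem h1, fractIoi, Set.indicator_of_mem h1,
      smul_eq_mul, mul_comm]
    ring_nf
  · rw [Set.indicator_of_notMem h1, Set.indicator_apply_eq_zero]
    intro _
    rw [fractIoi, Set.indicator_of_notMem h1, smul_zero]

lemma norm_mellin_fractIoi_le {s : ℂ} (hs : 0 < s.re) : ‖mellin fractIoi (-s)‖ ≤ 1 / s.re := by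
  rw [mellin_fractIoi_eq]
  have h : -(s.re + 1) < -1 := by linarith
  have := norm_integral_le_of_norm_le (μ := volume.restrict (Set.Ioi (1 : ℝ)))
    (f := fun t : ℝ => ((Int.fract t : ℝ) : ℂ) * (t : ℂ) ^ (-(s + 1)))
    (integrableOn_Ioi_rpow_of_lt h zero_lt_one)
    ((ae_restrict_iff' measurableSet_Ioi).2 (Eventually.of_forall fun t ht => ?_))
  · refine this.trans (le_of_eq ?_)
    rw [integral_Ioi_rpow_of_lt h zero_lt_one, Real.one_rpow]
    have : -(s.re + 1) + 1 = -s.re := by ring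
    rw [this, neg_div_neg_eq]
  · have ht0 : 0 < t := zero_lt_one.trans ht
    rw [norm_mul, norm_cpow_eq_rpow_re_of_pos ht0, norm_real, Real.norm_eq_abs, Int.abs_fract]
    simp only [neg_re, add_re, one_re]
    exact mul_le_of_le_one_left (Real.rpow_nonneg ht0.le _) (Int.fract_lt_one t).le

lemma riemannZeta_eq_of_one_lt_re {s : ℂ} (hs : 1 < s.re) :
    riemannZeta s = s / (s - 1) - s * mellin fractIoi (-s) := by
  have hO : (fun n : ℕ => ∑ k ∈ Finset.Icc 1 n, (1 : ℕ → ℂ) k) =O[atTop]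
      fun n : ℕ => (n : ℝ) ^ (1 : ℝ) :=
    IsBigO.of_bound 1 (Eventually.of_forall fun n => by simp)
  have h := LSeries_eq_mul_integral 1 zero_le_one hs (LSeriesSummable_one_iff.2 hs) hO
  rw [LSeries_one_eq_riemannZeta hs] at h
  have hre : (-(s + 1)).re < -1 := by
    simp only [neg_re, add_re, one_re]
    linarith
  have hre' : (-s).re < -1 := by
    simp only [neg_re]
    linarith
  have hi1 : IntegrableOn (fun t : ℝ => (t : ℂ) ^ (-s)) (Set.Ioi 1) :=
    integrableOn_Ioi_cpow_of_lt hre' zero_lt_one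
  have hi2 : IntegrableOn (fun t : ℝ => ((Int.fract t : ℝ) : ℂ) * (t : ℂ) ^ (-(s + 1)))
      (Set.Ioi 1) := by
    refine (integrableOn_Ioi_cpow_of_lt hre zero_lt_one).bdd_mul (c := 1)
      (measurable_ofReal.comp measurable_fract).aestronglyMeasurable
      (Eventually.of_forall fun t => ?_)
    rw [norm_real, Real.norm_eq_abs, Int.abs_fract]
    exact (Int.fract_lt_one t).le
  have hcongr : ∫ t in Set.Ioi (1 : ℝ),
      (∑ k ∈ Finset.Icc 1 ⌊t⌋₊, (1 : ℕ → ℂ) k) * (t : ℂ) ^ (-(s + 1)) =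
      ∫ t in Set.Ioi (1 : ℝ),
        ((t : ℂ) ^ (-s) - ((Int.fract t : ℝ) : ℂ) * (t : ℂ) ^ (-(s + 1))) := by
    refine setIntegral_congr_fun measurableSet_Ioi fun t ht => ?_
    have ht0 : (0 : ℝ) < t := zero_lt_one.trans ht
    have ht0' : (t : ℂ) ≠ 0 := by exact_mod_cast ht0.ne'
    have hfl : ((⌊t⌋₊ : ℕ) : ℂ) = t - ((Int.fract t : ℝ) : ℂ) := by
      have h1 : ((⌊t⌋₊ : ℕ) : ℝ) = t - Int.fract t := by
        rw [natCast_floor_eq_intCast_floor ht0.le, Int.self_sub_fract]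
      rw [← ofReal_sub, ← h1, ofReal_natCast]
    have hpow : (t : ℂ) ^ (-s) = t * (t : ℂ) ^ (-(s + 1)) := by
      rw [show -s = 1 + -(s + 1) by ring, cpow_add _ _ ht0', cpow_one]
    simp only [Pi.one_apply, Finset.sum_const, Nat.card_Icc, add_tsub_cancel_right, nsmul_eq_mul,
      mul_one]
    rw [hfl, hpow]
    ring
  rw [h, hcongr, integral_sub hi1 hi2, ← mellin_fractIoi_eq,
    integral_Ioi_cpow_of_lt hre' zero_lt_one, ofReal_one, one_cpow, mul_sub]
  have h1 : s - 1 ≠ 0 := fun h0 => by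
    rw [sub_eq_zero.1 h0] at hs
    simp at hs
  have h2 : -s + 1 ≠ 0 := fun h0 => h1 (by linear_combination -h0)
  congr 1
  field_simp
  ring

lemma riemannZeta_eq_of_re_pos {s : ℂ} (hs : 0 < s.re) (hs1 : s ≠ 1) :
    riemannZeta s = s / (s - 1) - s * mellin fractIoi (-s) := by
  set U : Set ℂ := {s | 0 < s.re} with hU
  have hUo : IsOpen U := isOpen_lt continuous_const continuous_re
  have hpre : IsPreconnected U := (convex_halfSpace_re_gt 0).isPreconnected
  have hg : DifferentiableOn ℂ (fun s => s - s * (s - 1) * mellin fractIoi (-s)) U := by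
    intro s hs
    have hs' : (-s).re < 0 := by simpa [hU] using hs
    have : DifferentiableAt ℂ (fun s => mellin fractIoi (-s)) s :=
      (differentiableAt_mellin_fractIoi hs').comp s differentiableAt_id.neg
    exact DifferentiableAt.differentiableWithinAt (by fun_prop)
  have h2 : (2 : ℂ) ∈ U := by simp [hU]
  have hev : riemannZeta₁ =ᶠ[𝓝 2] fun s => s - s * (s - 1) * mellin fractIoi (-s) := by
    have : ∀ᶠ s : ℂ in 𝓝 2, 1 < s.re :=
      continuous_re.continuousAt.eventually_const_lt (by norm_num)
    filter_upwards [this] with s hs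
    have hs1 : s ≠ 1 := fun h => by
      rw [h] at hs
      simp at hs
    have h1 := riemannZeta_eq_of_one_lt_re hs
    rw [riemannZeta_eq_inv_sub_mul hs1] at h1
    have := sub_ne_zero.2 hs1
    field_simp at h1
    rw [h1]
    ring
  have hEq := AnalyticOnNhd.eqOn_of_preconnected_of_eventuallyEq
    (differentiable_riemannZeta₁.differentiableOn.analyticOnNhd hUo)
    (hg.analyticOnNhd hUo) hpre h2 hev hs
  have := sub_ne_zero.2 hs1
  rw [riemannZeta_eq_inv_sub_mul hs1, hEq]
  field_simp

/-- Linear growth of `ζ` on the half-plane `Re s ≥ δ`, away from the real axis. -/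
lemma norm_riemannZeta_le {s : ℂ} {δ : ℝ} (hδ : 0 < δ) (hs : δ ≤ s.re) (him : 1 ≤ |s.im|) :
    ‖riemannZeta s‖ ≤ (1 + 1 / δ) * ‖s‖ := by
  have hs0 : 0 < s.re := hδ.trans_le hs
  have h1 : 1 ≤ ‖s - 1‖ := him.trans (by simpa using abs_im_le_norm (s - 1))
  have hs1 : s ≠ 1 := fun h => by
    rw [h] at h1
    norm_num at h1
  rw [riemannZeta_eq_of_re_pos hs0 hs1]
  refine (norm_sub_le _ _).trans ?_
  rw [norm_div, norm_mul, add_mul, one_mul, mul_comm (1 / δ)]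
  refine add_le_add (div_le_self (norm_nonneg _) h1) ?_
  exact mul_le_mul_of_nonneg_left ((norm_mellin_fractIoi_le hs0).trans
    (one_div_le_one_div_of_le hδ hs)) (norm_nonneg _)

/-- `1 / ζ` is bounded on every half-plane `Re s ≥ σ` with `σ > 1`. -/
lemma norm_inv_riemannZeta_le {σ : ℝ} (hσ : 1 < σ) :
    ∃ C : ℝ, ∀ s : ℂ, σ ≤ s.re → ‖(riemannZeta s)⁻¹‖ ≤ C := by
  have hsum : LSeriesSummable (fun n => ((ArithmeticFunction.moebius n : ℤ) : ℂ)) σ :=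
    ArithmeticFunction.LSeriesSummable_moebius_iff.2 (by simpa using hσ)
  refine ⟨∑' n, ‖LSeries.term (fun n => ((ArithmeticFunction.moebius n : ℤ) : ℂ)) σ n‖,
    fun s hs => ?_⟩
  · have hs1 : 1 < s.re := hσ.trans_le hs
    have h := LSeries_one_mul_Lseries_moebius hs1
    rw [LSeries_one_eq_riemannZeta hs1] at h
    rw [inv_eq_of_mul_eq_one_right h]
    exact tsum_of_norm_bounded hsum.norm.hasSum fun n =>
      LSeries.norm_term_le_of_re_le_re _ (by simpa using hs) n

lemma riemannZeta_add_isBigO {a b δ : ℝ} (hδ : 0 < δ) {w : ℂ} (hw : δ ≤ a + w.re) {e : ℂ → ℂ}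
    (he : ∀ s, e s = s + w) :
    (fun s => riemannZeta (e s)) =O[vertStrip a b] fun s => 1 + s.im ^ 2 := by
  refine IsBigO.of_bound ((1 + 1 / δ) * (|a| + |b| + ‖w‖ + 1)) (eventually_vertStrip_iff.2
    ⟨|w.im| + 1, fun s h1 h2 hs => ?_⟩)
  have hre : δ ≤ (s + w).re := by
    rw [add_re]
    linarith
  have him : 1 ≤ |(s + w).im| := by
    have := abs_sub_abs_le_abs_sub s.im (-w.im)
    rw [abs_neg, sub_neg_eq_add] at this
    rw [add_im]
    linarith
  rw [he, Real.norm_eq_abs, abs_of_pos (by positivity : 0 < 1 + s.im ^ 2), mul_assoc]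
  refine (norm_riemannZeta_le hδ hre him).trans
    (mul_le_mul_of_nonneg_left ?_ (by positivity))
  have hn : ‖s + w‖ ≤ |s.re| + |s.im| + ‖w‖ :=
    (norm_add_le _ _).trans (by gcongr; exact norm_le_abs_re_add_abs_im s)
  have hr : |s.re| ≤ |a| + |b| :=
    (abs_le_max_abs_abs h1 h2).trans (max_le_add_of_nonneg (abs_nonneg _) (abs_nonneg _))
  have hi : |s.im| ≤ 1 + s.im ^ 2 := by
    rw [← sq_abs s.im]
    nlinarith [sq_nonneg (|s.im| - 1), abs_nonneg s.im]
  have hp : 0 ≤ (|a| + |b| + ‖w‖) * s.im ^ 2 := by positivity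
  nlinarith

lemma mellin_isBigO {a b α β : ℝ} (ha : 0 < a) {V : ℝ → ℂ} (hα : 0 < α)
    (hd : ContDiff ℝ (⊤ : ℕ∞) V) (hV : ∀ t ∉ Set.Icc α β, V t = 0) (k : ℕ) :
    mellin V =O[vertStrip a b] fun s => ((1 + s.im ^ 2) ^ k)⁻¹ := by
  obtain ⟨C, hC⟩ := norm_pow_mul_mellin_le hα hd hV a b (2 * k)
  refine IsBigO.of_bound ((1 + 1 / a ^ 2) ^ k * C) (eventually_vertStrip_iff.2
    ⟨0, fun s h1 h2 _ => ?_⟩)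
  have hs := hC s h1 h2
  have hQ : 1 + s.im ^ 2 ≤ (1 + 1 / a ^ 2) * ‖s‖ ^ 2 := by
    have h3 : a ^ 2 ≤ s.re ^ 2 := pow_le_pow_left₀ ha.le h1 2
    have h4 : 1 ≤ 1 / a ^ 2 * s.re ^ 2 := by
      rw [one_div_mul_eq_div, one_le_div (by positivity)]
      exact h3
    have h5 : 0 ≤ 1 / a ^ 2 * s.im ^ 2 := by positivity
    rw [← normSq_eq_norm_sq, normSq_apply]
    nlinarith [sq_nonneg s.re]
  have hQk : (1 + s.im ^ 2) ^ k ≤ (1 + 1 / a ^ 2) ^ k * ‖s‖ ^ (2 * k) := by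
    rw [pow_mul, ← mul_pow]
    exact pow_le_pow_left₀ (by positivity) hQ k
  have hpos : 0 < (1 + s.im ^ 2) ^ k := by positivity
  rw [norm_inv, Real.norm_eq_abs, abs_of_pos hpos, ← div_eq_mul_inv, le_div_iff₀ hpos]
  calc ‖mellin V s‖ * (1 + s.im ^ 2) ^ k
      ≤ ‖mellin V s‖ * ((1 + 1 / a ^ 2) ^ k * ‖s‖ ^ (2 * k)) := by gcongr
    _ = (1 + 1 / a ^ 2) ^ k * (‖s‖ ^ (2 * k) * ‖mellin V s‖) := by ring
    _ ≤ (1 + 1 / a ^ 2) ^ k * C := by gcongr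

lemma cpow_isBigO_one {a b y : ℝ} (hy : 0 < y) :
    (fun s : ℂ => (y : ℂ) ^ s) =O[vertStrip a b] fun _ => (1 : ℝ) := by
  refine IsBigO.of_bound (y ^ a + y ^ b) (eventually_vertStrip_iff.2 ⟨0, fun s h1 h2 _ => ?_⟩)
  rw [norm_cpow_eq_rpow_re_of_pos hy, norm_one, mul_one]
  exact rpow_le_rpow_add_rpow hy h1 h2

lemma tendsto_mul_riemannZeta {p : ℂ} {e : ℂ → ℂ} (he : ∀ s, e s = s - p + 1) :
    Tendsto (fun s => (s - p) * riemannZeta (e s)) (𝓝[≠] p) (𝓝 1) := by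
  have he' : Tendsto e (𝓝[≠] p) (𝓝[≠] 1) := by
    refine tendsto_nhdsWithin_iff.2 ⟨?_, ?_⟩
    · have : ContinuousAt e p := by
        rw [funext he]
        fun_prop
      have h := this.tendsto.mono_left (nhdsWithin_le_nhds (s := {p}ᶜ))
      rwa [he p, sub_self, zero_add] at h
    · filter_upwards [eventually_mem_nhdsWithin] with s hs
      intro h
      rw [Set.mem_singleton_iff, he] at h
      exact hs (Set.mem_singleton_iff.2 (by linear_combination h))
  refine (riemannZeta_residue_one.comp he').congr fun s => ?_
  simp only [Function.comp_apply]
  rw [he]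
  ring

lemma differentiableAt_riemannZeta_comp {e : ℂ → ℂ} {s : ℂ} (he : DifferentiableAt ℂ e s)
    (h : e s ≠ 1) : DifferentiableAt ℂ (fun s => riemannZeta (e s)) s :=
  (differentiableAt_riemannZeta h).comp s he

lemma tendsto_mul_of_tendsto_of_continuousAt {p : ℂ} {Z g f : ℂ → ℂ}
    (hZ : Tendsto (fun s => (s - p) * Z s) (𝓝[≠] p) (𝓝 1)) (hg : DifferentiableAt ℂ g p)
    (hf : ∀ s, f s = Z s * g s) :
    Tendsto (fun s => (s - p) * f s) (𝓝[≠] p) (𝓝 (g p)) := by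
  have := hZ.mul (hg.continuousAt.tendsto.mono_left (nhdsWithin_le_nhds (s := {p}ᶜ)))
  rw [one_mul] at this
  refine this.congr fun s => ?_
  rw [hf]
  ring

/-- Under RH, contour shift for `H(s₁,s₂;y)`: the integral over `Re s₃ = 3/2`
equals the four residues plus the integral over `Re s₃ = c₃'`. -/
theorem H_contour_shift (hRH : RiemannHypothesis) (U : ℝ) (hU : 2 ≤ U) (W : Weight U)
    (y : ℝ) (hy : 0 < y)
    (s₁ s₂ : ℂ) (h₁ : 1 < s₁.re) (h₁' : s₁.re < 2) (h₂ : 1 < s₂.re) (h₂' : s₂.re < 2)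
    (hne : s₁ ≠ s₂) (hsum : s₁ + s₂ ≠ 3)
    (c₃' : ℝ) (hc₃l : 3 / 4 ≤ c₃')
    (hc₃u : c₃' < min (min 1 (2 - s₁.re)) (min (2 - s₂.re) (3 - (s₁.re + s₂.re)))) :
    VI (3 / 2) (fun s₃ =>
        riemannZeta s₃ * riemannZeta (s₃ + s₁ - 1) * riemannZeta (s₃ + s₂ - 1) *
            riemannZeta (s₃ + s₁ + s₂ - 2) / riemannZeta (2 * s₃ + s₁ + s₂ - 2) *
          mellinW W.toFun s₃ * (y : ℂ) ^ s₃) =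
      riemannZeta s₁ * riemannZeta s₂ * riemannZeta (s₁ + s₂ - 1) / riemannZeta (s₁ + s₂) *
          (y : ℂ) * mellinW W.toFun 1
      + riemannZeta (2 - s₂) * riemannZeta (1 - s₂ + s₁) * riemannZeta s₁ /
            riemannZeta (2 + s₁ - s₂) * (y : ℂ) ^ (2 - s₂) * mellinW W.toFun (2 - s₂)
      + riemannZeta (2 - s₁) * riemannZeta (1 - s₁ + s₂) * riemannZeta s₂ /
            riemannZeta (2 + s₂ - s₁) * (y : ℂ) ^ (2 - s₁) * mellinW W.toFun (2 - s₁)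
      + riemannZeta (3 - s₁ - s₂) * riemannZeta (2 - s₁) * riemannZeta (2 - s₂) /
            riemannZeta (4 - (s₁ + s₂)) * (y : ℂ) ^ (3 - s₁ - s₂) *
          mellinW W.toFun (3 - s₁ - s₂)
      + VI c₃' (fun s₃ =>
          riemannZeta s₃ * riemannZeta (s₃ + s₁ - 1) * riemannZeta (s₃ + s₂ - 1) *
              riemannZeta (s₃ + s₁ + s₂ - 2) / riemannZeta (2 * s₃ + s₁ + s₂ - 2) *
            mellinW W.toFun s₃ * (y : ℂ) ^ s₃) := by
  obtain ⟨⟨hc1, hc2⟩, hc3, hc4⟩ : (c₃' < 1 ∧ c₃' < 2 - s₁.re) ∧ c₃' < 2 - s₂.re ∧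
      c₃' < 3 - (s₁.re + s₂.re) := by
    simpa only [lt_min_iff] using hc₃u
  have hα : 0 < 1 / (2 * U) := by positivity
  have hVd : ContDiff ℝ (⊤ : ℕ∞) fun t => (W.toFun t : ℂ) := ofRealCLM.contDiff.comp W.smooth
  have hV : ∀ t ∉ Set.Icc (1 / (2 * U)) (1 + 1 / (2 * U)), (W.toFun t : ℂ) = 0 := fun t ht => by
    rw [W.support_subset t ht, ofReal_zero]
  rw [mellinW_eq_mellin]
  set M : ℂ → ℂ := mellin fun t => (W.toFun t : ℂ)
  have hM : Differentiable ℂ M := differentiable_mellin_of_eq_zero hα hVd.continuous hV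
  have hy0 : (y : ℂ) ≠ 0 := by exact_mod_cast hy.ne'
  have hyd : Differentiable ℂ fun s : ℂ => (y : ℂ) ^ s := fun s =>
    differentiableAt_id.const_cpow (Or.inl hy0)
  have ne_of_re {z w : ℂ} (h : z.re ≠ w.re) : z ≠ w := fun h' => h (by rw [h'])
  have hD {s : ℂ} (hs : c₃' ≤ s.re) :
      DifferentiableAt ℂ (fun s => riemannZeta (2 * s + s₁ + s₂ - 2)) s ∧
        riemannZeta (2 * s + s₁ + s₂ - 2) ≠ 0 := by
    have : 1 < (2 * s + s₁ + s₂ - 2).re := by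
      simp
      linarith
    exact ⟨differentiableAt_riemannZeta_comp (by fun_prop) (ne_of_re (by simpa using this.ne')),
      riemannZeta_ne_zero_of_one_lt_re this⟩
  set f : ℂ → ℂ := fun s =>
    riemannZeta s * riemannZeta (s + s₁ - 1) * riemannZeta (s + s₂ - 1) *
      riemannZeta (s + s₁ + s₂ - 2) / riemannZeta (2 * s + s₁ + s₂ - 2) * M s * (y : ℂ) ^ s with hf
  have hd1 {s : ℂ} (h : s ≠ 1) : DifferentiableAt ℂ riemannZeta s := differentiableAt_riemannZeta h
  have hd2 {s : ℂ} (h : s ≠ 2 - s₁) :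
      DifferentiableAt ℂ (fun s => riemannZeta (s + s₁ - 1)) s :=
    differentiableAt_riemannZeta_comp (by fun_prop) fun h' => h (by linear_combination h')
  have hd3 {s : ℂ} (h : s ≠ 2 - s₂) :
      DifferentiableAt ℂ (fun s => riemannZeta (s + s₂ - 1)) s :=
    differentiableAt_riemannZeta_comp (by fun_prop) fun h' => h (by linear_combination h')
  have hd4 {s : ℂ} (h : s ≠ 3 - s₁ - s₂) :
      DifferentiableAt ℂ (fun s => riemannZeta (s + s₁ + s₂ - 2)) s :=
    differentiableAt_riemannZeta_comp (by fun_prop) fun h' => h (by linear_combination h')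
  have n12 : (1 : ℂ) ≠ 2 - s₂ := ne_of_re (by simp; linarith)
  have n13 : (1 : ℂ) ≠ 2 - s₁ := ne_of_re (by simp; linarith)
  have n14 : (1 : ℂ) ≠ 3 - s₁ - s₂ := ne_of_re (by simp; linarith)
  have n23 : 2 - s₂ ≠ 2 - s₁ := fun h => hne (by linear_combination h)
  have n24 : 2 - s₂ ≠ 3 - s₁ - s₂ := ne_of_re (by simp; linarith)
  have n34 : 2 - s₁ ≠ 3 - s₁ - s₂ := ne_of_re (by simp; linarith)
  have re1 : c₃' ≤ (1 : ℂ).re := by simpa using hc1.le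
  have re2 : c₃' ≤ (2 - s₂).re := by simpa using hc3.le
  have re3 : c₃' ≤ (2 - s₁).re := by simpa using hc2.le
  have re4 : c₃' ≤ (3 - s₁ - s₂).re := by
    simp
    linarith
  have r1 := tendsto_mul_of_tendsto_of_continuousAt (p := 1) (f := f)
    (g := fun s => riemannZeta (s + s₁ - 1) * riemannZeta (s + s₂ - 1) *
      riemannZeta (s + s₁ + s₂ - 2) / riemannZeta (2 * s + s₁ + s₂ - 2) * M s * (y : ℂ) ^ s)
    (tendsto_mul_riemannZeta (e := fun s => s) fun s => by ring)
    ((((((hd2 n13).mul (hd3 n12)).mul (hd4 n14)).div (hD re1).1 (hD re1).2).mul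
      hM.differentiableAt).mul hyd.differentiableAt) (fun s => by simp only [hf]; ring)
  have r2 := tendsto_mul_of_tendsto_of_continuousAt (p := 2 - s₂) (f := f)
    (g := fun s => riemannZeta s * riemannZeta (s + s₁ - 1) *
      riemannZeta (s + s₁ + s₂ - 2) / riemannZeta (2 * s + s₁ + s₂ - 2) * M s * (y : ℂ) ^ s)
    (tendsto_mul_riemannZeta (e := fun s => s + s₂ - 1) fun s => by ring)
    ((((((hd1 n12.symm).mul (hd2 n23)).mul (hd4 n24)).div (hD re2).1 (hD re2).2).mul
      hM.differentiableAt).mul hyd.differentiableAt) (fun s => by simp only [hf]; ring)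
  have r3 := tendsto_mul_of_tendsto_of_continuousAt (p := 2 - s₁) (f := f)
    (g := fun s => riemannZeta s * riemannZeta (s + s₂ - 1) *
      riemannZeta (s + s₁ + s₂ - 2) / riemannZeta (2 * s + s₁ + s₂ - 2) * M s * (y : ℂ) ^ s)
    (tendsto_mul_riemannZeta (e := fun s => s + s₁ - 1) fun s => by ring)
    ((((((hd1 n13.symm).mul (hd3 n23.symm)).mul (hd4 n34)).div (hD re3).1 (hD re3).2).mul
      hM.differentiableAt).mul hyd.differentiableAt) (fun s => by simp only [hf]; ring)
  have r4 := tendsto_mul_of_tendsto_of_continuousAt (p := 3 - s₁ - s₂) (f := f)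
    (g := fun s => riemannZeta s * riemannZeta (s + s₁ - 1) *
      riemannZeta (s + s₂ - 1) / riemannZeta (2 * s + s₁ + s₂ - 2) * M s * (y : ℂ) ^ s)
    (tendsto_mul_riemannZeta (e := fun s => s + s₁ + s₂ - 2) fun s => by ring)
    ((((((hd1 n14.symm).mul (hd2 n34.symm)).mul (hd3 n24.symm)).div (hD re4).1 (hD re4).2).mul
      hM.differentiableAt).mul hyd.differentiableAt) (fun s => by simp only [hf]; ring)
  have hO : f =O[vertStrip c₃' (3 / 2)] fun s => (1 + s.im ^ 2)⁻¹ := by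
    have o1 := riemannZeta_add_isBigO (a := c₃') (b := 3 / 2) (δ := 3 / 4) (by norm_num)
      (w := 0) (by simpa using hc₃l) (e := fun s => s) (fun s => by ring)
    have o2 := riemannZeta_add_isBigO (a := c₃') (b := 3 / 2) (δ := 3 / 4) (by norm_num)
      (w := s₁ - 1) (by simp; linarith) (e := fun s => s + s₁ - 1) (fun s => by ring)
    have o3 := riemannZeta_add_isBigO (a := c₃') (b := 3 / 2) (δ := 3 / 4) (by norm_num)
      (w := s₂ - 1) (by simp; linarith) (e := fun s => s + s₂ - 1) (fun s => by ring)
    have o4 := riemannZeta_add_isBigO (a := c₃') (b := 3 / 2) (δ := 3 / 4) (by norm_num)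
      (w := s₁ + s₂ - 2) (by simp; linarith) (e := fun s => s + s₁ + s₂ - 2) (fun s => by ring)
    have o5 : (fun s => (riemannZeta (2 * s + s₁ + s₂ - 2))⁻¹) =O[vertStrip c₃' (3 / 2)]
        fun _ => (1 : ℝ) := by
      obtain ⟨C, hC⟩ := norm_inv_riemannZeta_le (σ := 3 / 2) (by norm_num)
      refine IsBigO.of_bound C (eventually_vertStrip_iff.2 ⟨0, fun s h1 _ _ => ?_⟩)
      rw [norm_one, mul_one]
      refine hC _ ?_
      simp
      linarith
    have o6 := mellin_isBigO (a := c₃') (b := 3 / 2) (by linarith) hα hVd hV 5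
    have o7 := cpow_isBigO_one (a := c₃') (b := 3 / 2) hy
    refine ((((((o1.mul o2).mul o3).mul o4).mul o5).mul o6).mul o7).congr (fun s => ?_)
      (fun s => ?_)
    · simp only [hf, div_eq_mul_inv, M]
    · have : 1 + s.im ^ 2 ≠ 0 := by positivity
      field_simp
  have lims : ∀ p ∈ ({1, 2 - s₂, 2 - s₁, 3 - s₁ - s₂} : Finset ℂ),
      ∃ r, Tendsto (fun s => (s - p) * f s) (𝓝[≠] p) (𝓝 r) := by
    intro p hp
    simp only [Finset.mem_insert, Finset.mem_singleton] at hp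
    rcases hp with rfl | rfl | rfl | rfl
    exacts [⟨_, r1⟩, ⟨_, r2⟩, ⟨_, r3⟩, ⟨_, r4⟩]
  have main := VI_eq_sum_residues_add (a := c₃') (b := 3 / 2) (by linarith)
    {1, 2 - s₂, 2 - s₁, 3 - s₁ - s₂} f
    (fun p => limUnder (𝓝[≠] p) fun s => (s - p) * f s) ?_ ?_
    (fun p hp => tendsto_nhds_limUnder (lims p hp)) hO
  · rw [Finset.sum_insert (by simp [n12, n13, n14]), Finset.sum_insert (by simp [n23, n24]),
      Finset.sum_insert (by simp [n34]), Finset.sum_singleton, r1.limUnder_eq, r2.limUnder_eq,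
      r3.limUnder_eq, r4.limUnder_eq] at main
    rw [main, cpow_one]
    ring_nf
  · intro p hp
    simp only [Finset.mem_insert, Finset.mem_singleton] at hp
    rcases hp with rfl | rfl | rfl | rfl <;> constructor <;> simp <;> linarith
  · intro s h1 _ h3
    simp only [Finset.mem_insert, Finset.mem_singleton, not_or] at h3
    obtain ⟨h4, h5, h6, h7⟩ := h3
    exact (((((((hd1 h4).mul (hd2 h6)).mul (hd3 h5)).mul (hd4 h7)).div (hD h1).1 (hD h1).2).mul
      hM.differentiableAt).mul hyd.differentiableAt)
end

section
/- Assume the Riemann Hypothesis. Fix ε > 0, a weight W as described, and real numbers c₁, c₂ with 1 < c₁ < c₂ < 2. Then for all large x, y > 0, C₁ := (1/(2πi))² ∫_{Re s₁ = c₁} ∫_{Re s₂ = c₂} (ζ(s₁+s₂−1)/ζ(s₁+s₂)) · y Ŵ(1) x^{s₁+s₂} Ŵ(s₁) Ŵ(s₂) ds₂ ds₁ satisfies C₁ = (y x²/ζ(2)) Ŵ(1) · (1/(2πi)) ∫_{Re s = c₂} Ŵ(2−s) Ŵ(s) ds + O(y x^{1/2+ε}), with an implied constant depending only on ε, c₁,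 c₂ and W. -/
open Complex Filter

section

open MeasureTheory Set Asymptotics Topology

/-- `g` is continuous on `(0, ∞)` and `O(min 1 t⁻²)`. -/
structure StripDecay (g : ℝ → ℂ) : Prop where
  cont : ContinuousOn g (Ioi 0)
  bound : ∃ C, ∀ t, 0 < t → ‖g t‖ ≤ C ∧ ‖g t‖ * t ^ 2 ≤ C

namespace StripDecay

variable {g : ℝ → ℂ}

lemma isBigO_zero (hg : StripDecay g) : g =O[𝓝[>] 0] (fun t : ℝ => t ^ (-(0 : ℝ))) := by
  obtain ⟨C, hC⟩ := hg.bound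
  refine IsBigO.of_bound C ?_
  filter_upwards [self_mem_nhdsWithin] with t ht
  simpa using (hC t ht).1

lemma isBigO_top (hg : StripDecay g) : g =O[atTop] (fun t : ℝ => t ^ (-(2 : ℝ))) := by
  obtain ⟨C, hC⟩ := hg.bound
  refine IsBigO.of_bound C ?_
  filter_upwards [eventually_gt_atTop 0] with t ht
  rw [Real.rpow_neg ht.le, Real.rpow_two, norm_inv, norm_pow, Real.norm_of_nonneg ht.le,
    ← div_eq_mul_inv, le_div_iff₀ (by positivity)]
  exact (hC t ht).2

lemma mellinConvergent (hg : StripDecay g) {s : ℂ} (h0 : 0 < s.re) (h2 : s.re < 2) : MellinConvergent g s :=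
  mellinConvergent_of_isBigO_rpow (hg.cont.locallyIntegrableOn measurableSet_Ioi)
    hg.isBigO_top h2 hg.isBigO_zero h0

lemma differentiableAt_mellin (hg : StripDecay g) {s : ℂ} (h0 : 0 < s.re) (h2 : s.re < 2) :
    DifferentiableAt ℂ (mellin g) s :=
  mellin_differentiableAt_of_isBigO_rpow (hg.cont.locallyIntegrableOn measurableSet_Ioi)
    hg.isBigO_top h2 hg.isBigO_zero h0

lemma integrableOn_norm (hg : StripDecay g) {σ : ℝ} (h0 : 0 < σ) (h2 : σ < 2) :
    IntegrableOn (fun t : ℝ => t ^ (σ - 1) * ‖g t‖) (Ioi 0) := by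
  have h := (hg.mellinConvergent (s := (σ : ℂ)) (by simpa) (by simpa)).norm
  refine IntegrableOn.congr_fun h (fun t (ht : 0 < t) => ?_) measurableSet_Ioi
  simp [norm_cpow_eq_rpow_re_of_pos ht]

lemma exists_norm_mellin_le (hg : StripDecay g) {a b : ℝ} (ha : 0 < a) (hb : b < 2) :
    ∃ K, ∀ s : ℂ, a ≤ s.re → s.re ≤ b → ‖mellin g s‖ ≤ K := by
  rcases lt_or_ge b a with hab | hab
  · exact ⟨0, fun s h1 h2 => absurd (h1.trans h2) hab.not_ge⟩
  have Ia := hg.integrableOn_norm ha (hab.trans_lt hb)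
  have Ib := hg.integrableOn_norm (ha.trans_le hab) hb
  refine ⟨∫ t in Ioi (0 : ℝ), (t ^ (a - 1) * ‖g t‖ + t ^ (b - 1) * ‖g t‖), fun s h1 h2 => ?_⟩
  refine norm_integral_le_of_norm_le (Ia.add Ib) ?_
  filter_upwards [ae_restrict_mem measurableSet_Ioi] with t ht
  have ht : 0 < t := ht
  rw [norm_smul, norm_cpow_eq_rpow_re_of_pos ht, ← add_mul]
  refine mul_le_mul_of_nonneg_right ?_ (norm_nonneg _)
  have pa := Real.rpow_nonneg ht.le (a - 1)
  have pb := Real.rpow_nonneg ht.le (b - 1)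
  simp only [sub_re, one_re]
  rcases le_total 1 t with h | h
  · linarith [Real.rpow_le_rpow_of_exponent_le h (sub_le_sub_right h2 1)]
  · linarith [Real.rpow_le_rpow_of_exponent_ge ht h (sub_le_sub_right h1 1)]

end StripDecay

/-- Integration by parts for the Mellin transform: the Euler operator `t d/dt` becomes
multiplication by `-s`. -/
lemma mellin_eulerDeriv {g g' : ℝ → ℂ} (hg : StripDecay g) (hg' : StripDecay g')
    (hd : ∀ t, 0 < t → HasDerivAt g (g' t / t) t) {s : ℂ} (h0 : 0 < s.re) (h2 : s.re < 2) :
    mellin g' s = -s * mellin g s := by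
  have hs : s ≠ 0 := fun h => by simp [h] at h0
  obtain ⟨C, hC⟩ := hg.bound
  have key := integral_Ioi_mul_deriv_eq_deriv_mul (a := (0 : ℝ))
    (u := fun t : ℝ => (t : ℂ) ^ s) (u' := fun t : ℝ => s * (t : ℂ) ^ (s - 1))
    (v := g) (v' := fun t => g' t / t) (a' := 0) (b' := 0)
    (fun t (ht : 0 < t) => by
      simpa using ((hasDerivAt_id (t : ℂ)).cpow_const (c := s)
        (Or.inl (by simpa using ht))).comp_ofReal)
    (fun t ht => hd t ht) ?_ ?_ ?_ ?_
  · rw [sub_self, zero_sub] at key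
    have e1 : mellin g' s = ∫ t in Ioi (0:ℝ), (t : ℂ) ^ s * (g' t / t) := by
      refine setIntegral_congr_fun measurableSet_Ioi fun t (ht : 0 < t) => ?_
      have : (t : ℂ) ≠ 0 := by exact_mod_cast ht.ne'
      simp only [smul_eq_mul, cpow_sub _ _ this, cpow_one]
      ring
    rw [e1, key, neg_mul, neg_inj, mellin, ← integral_const_mul]
    refine setIntegral_congr_fun measurableSet_Ioi fun t _ => ?_
    simp [mul_assoc]
  · refine (hg'.mellinConvergent h0 h2).congr_fun (fun t (ht : 0 < t) => ?_) measurableSet_Ioi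
    have : (t : ℂ) ≠ 0 := by exact_mod_cast ht.ne'
    simp only [smul_eq_mul, cpow_sub _ _ this, cpow_one, Pi.mul_apply]
    ring
  · refine IntegrableOn.congr_fun ((hg.mellinConvergent h0 h2).const_mul s) (fun t (ht : 0 < t) => ?_)
      measurableSet_Ioi
    simp [mul_assoc]
  · rw [tendsto_zero_iff_norm_tendsto_zero]
    have h : Tendsto (fun t : ℝ => t ^ s.re * C) (𝓝[>] 0) (𝓝 0) := by
      have := ((Real.continuousAt_rpow_const 0 s.re (Or.inr h0.le)).tendsto.mono_left
        (nhdsWithin_le_nhds (s := Ioi 0))).mul_const C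
      simpa [Real.zero_rpow h0.ne'] using this
    refine squeeze_zero' (Eventually.of_forall fun _ => norm_nonneg _) ?_ h
    filter_upwards [self_mem_nhdsWithin] with t (ht : 0 < t)
    rw [Pi.mul_apply, norm_mul, norm_cpow_eq_rpow_re_of_pos ht]
    exact mul_le_mul_of_nonneg_left (hC t ht).1 (by positivity)
  · rw [tendsto_zero_iff_norm_tendsto_zero]
    have h : Tendsto (fun t : ℝ => t ^ (-(2 - s.re)) * C) atTop (𝓝 0) := by
      simpa using (tendsto_rpow_neg_atTop (y := 2 - s.re) (by linarith)).mul_const C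
    refine squeeze_zero' (Eventually.of_forall fun _ => norm_nonneg _) ?_ h
    filter_upwards [eventually_gt_atTop 0] with t ht
    rw [Pi.mul_apply, norm_mul, norm_cpow_eq_rpow_re_of_pos ht]
    have : t ^ s.re = t ^ (-(2 - s.re)) * t ^ 2 := by
      rw [← Real.rpow_two, ← Real.rpow_add ht]; ring_nf
    rw [this, mul_assoc, mul_comm (t ^ 2)]
    exact mul_le_mul_of_nonneg_left (hC t ht).2 (by positivity)

/-- A sequence of functions, each obtained from the previous one by the Euler operator `t d/dt`,
all of which are `O(min 1 t⁻²)` on `(0, ∞)`. -/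
structure EulerChain (f : ℕ → ℝ → ℂ) : Prop where
  deriv : ∀ k t, 0 < t → HasDerivAt (f k) (f (k + 1) t / t) t
  bound : ∀ k, ∃ C, ∀ t, 0 < t → ‖f k t‖ ≤ C ∧ ‖f k t‖ * t ^ 2 ≤ C

namespace EulerChain

variable {f : ℕ → ℝ → ℂ}

lemma stripDecay (hf : EulerChain f) (k : ℕ) : StripDecay (f k) :=
  ⟨fun t ht => (hf.deriv k t ht).continuousAt.continuousWithinAt, hf.bound k⟩

lemma mellin_eq (hf : EulerChain f) (k : ℕ) {s : ℂ} (h0 : 0 < s.re) (h2 : s.re < 2) :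
    mellin (f k) s = (-s) ^ k * mellin (f 0) s := by
  induction k with
  | zero => simp
  | succ k ih =>
    rw [mellin_eulerDeriv (hf.stripDecay k) (hf.stripDecay (k + 1)) (hf.deriv k) h0 h2, ih]
    ring

lemma exists_decay (hf : EulerChain f) (k : ℕ) {a b : ℝ} (ha : 0 < a) (hb : b < 2) :
    ∃ K, 0 < K ∧ ∀ s : ℂ, a ≤ s.re → s.re ≤ b →
      ‖mellin (f 0) s‖ ≤ K * ((1 + |s.im|) ^ k)⁻¹ := by
  obtain ⟨K, hK⟩ := (hf.stripDecay k).exists_norm_mellin_le ha hb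
  refine ⟨(1 / a + 1) ^ k * |K| + 1, by positivity, fun s h1 h2 => ?_⟩
  have e := hK s h1 h2
  rw [hf.mellin_eq k (ha.trans_le h1) (h2.trans_lt hb), norm_mul, norm_pow, norm_neg] at e
  rw [← div_eq_mul_inv, le_div_iff₀ (by positivity)]
  have h3 : 1 + |s.im| ≤ (1 / a + 1) * ‖s‖ := by
    have := (h1.trans (le_abs_self _)).trans (abs_re_le_norm s)
    have h4 : 1 ≤ 1 / a * ‖s‖ := by rw [one_div, ← div_eq_inv_mul, le_div_iff₀ ha]; linarith
    linarith [abs_im_le_norm s]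
  calc ‖mellin (f 0) s‖ * (1 + |s.im|) ^ k
      ≤ ‖mellin (f 0) s‖ * ((1 / a + 1) * ‖s‖) ^ k := by gcongr
    _ = (1 / a + 1) ^ k * (‖s‖ ^ k * ‖mellin (f 0) s‖) := by rw [mul_pow]; ring
    _ ≤ (1 / a + 1) ^ k * |K| := by gcongr; exact e.trans (le_abs_self K)
    _ ≤ _ := by linarith

end EulerChain

/-- The vertical line `Re s = σ`. -/
lemma continuous_vertical (σ : ℝ) : Continuous fun t : ℝ => (σ : ℂ) + t * I := by fun_prop

lemma integrable_one_add_abs_sq_inv : Integrable fun t : ℝ => ((1 + |t|) ^ 2)⁻¹ := by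
  refine integrable_inv_one_add_sq.mono' (by fun_prop) (Eventually.of_forall fun t => ?_)
  rw [Real.norm_of_nonneg (by positivity)]
  apply inv_anti₀ (by positivity)
  nlinarith [abs_nonneg t, sq_abs t]

lemma EulerChain.verticalIntegrable {f : ℕ → ℝ → ℂ} (hf : EulerChain f) {σ : ℝ} (h0 : 0 < σ)
    (h2 : σ < 2) : VerticalIntegrable (mellin (f 0)) σ := by
  obtain ⟨K, -, hK⟩ := hf.exists_decay 2 h0 h2
  refine (integrable_one_add_abs_sq_inv.const_mul K).mono' ?_ (Eventually.of_forall fun t => ?_)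
  · refine Continuous.aestronglyMeasurable ?_
    refine continuous_iff_continuousAt.2 fun t => ?_
    refine ContinuousAt.comp (g := mellin (f 0)) (f := fun t : ℝ => (σ : ℂ) + t * I) ?_
      (continuous_vertical σ).continuousAt
    exact ((hf.stripDecay 0).differentiableAt_mellin (by simpa) (by simpa)).continuousAt
  · simpa using hK (σ + t * I) (by simp) (by simp)

lemma EulerChain.mellinInv_mellin {f : ℕ → ℝ → ℂ} (hf : EulerChain f) {σ : ℝ} (h0 : 0 < σ)
    (h2 : σ < 2) {x : ℝ} (hx : 0 < x) : mellinInv σ (mellin (f 0)) x = f 0 x :=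
  mellinInv_mellin_eq σ (f 0) hx ((hf.stripDecay 0).mellinConvergent (by simpa) (by simpa))
    (hf.verticalIntegrable h0 h2) (hf.deriv 0 x hx).continuousAt

/-- A smooth function on `ℝ` supported in `[a, B]`. -/
structure IsTest (a B : ℝ) (V : ℝ → ℝ) : Prop where
  smooth : ContDiff ℝ (⊤ : ℕ∞) V
  eq_zero : ∀ t, t ∉ Icc a B → V t = 0

/-- The Euler operator `t d/dt`. -/
noncomputable def eulerOp (V : ℝ → ℝ) (t : ℝ) : ℝ := t * deriv V t

namespace IsTest

variable {a B : ℝ} {V : ℝ → ℝ}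

lemma differentiable (hV : IsTest a B V) : Differentiable ℝ V :=
  hV.smooth.differentiable (by simp)

lemma contDiff_deriv (hV : IsTest a B V) : ContDiff ℝ (⊤ : ℕ∞) (deriv V) :=
  (contDiff_infty_iff_deriv.1 hV.smooth).2

lemma eulerOp (hV : IsTest a B V) : IsTest a B (eulerOp V) where
  smooth := contDiff_id.mul hV.contDiff_deriv
  eq_zero t ht := by
    have : V =ᶠ[𝓝 t] fun _ => 0 := by
      filter_upwards [isClosed_Icc.isOpen_compl.mem_nhds ht] with x hx using hV.eq_zero x hx
    simp [_root_.eulerOp, this.deriv_eq]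

lemma iterate_eulerOp (hV : IsTest a B V) (k : ℕ) : IsTest a B (_root_.eulerOp^[k] V) := by
  induction k with
  | zero => simpa
  | succ k ih => rw [Function.iterate_succ_apply']; exact ih.eulerOp

lemma mul_self (hV : IsTest a B V) : IsTest a B (fun t => V t ^ 2) where
  smooth := hV.smooth.pow 2
  eq_zero t ht := by simp [hV.eq_zero t ht]

lemma hasCompactSupport (hV : IsTest a B V) : HasCompactSupport V :=
  HasCompactSupport.intro isCompact_Icc hV.eq_zero

lemma exists_bound (hV : IsTest a B V) : ∃ M, ∀ t, |V t| ≤ M :=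
  hV.smooth.continuous.bounded_above_of_compact_support hV.hasCompactSupport

lemma hasDerivAt (hV : IsTest a B V) {t : ℝ} (ht : 0 < t) :
    HasDerivAt V (_root_.eulerOp V t / t) t := by
  have := (hV.differentiable t).hasDerivAt
  rwa [_root_.eulerOp, mul_div_cancel_left₀ _ ht.ne']

lemma eulerChain (hV : IsTest a B V) (hB : 0 < B) :
    EulerChain (fun k t => ((_root_.eulerOp^[k] V t : ℝ) : ℂ)) where
  deriv k t ht := by
    have := ((hV.iterate_eulerOp k).hasDerivAt ht).ofReal_comp
    rw [Function.iterate_succ_apply']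
    exact_mod_cast this
  bound k := by
    obtain ⟨M, hM⟩ := (hV.iterate_eulerOp k).exists_bound
    have hM0 : 0 ≤ M := (abs_nonneg _).trans (hM 0)
    refine ⟨M * (1 + B ^ 2), fun t ht => ?_⟩
    rw [norm_real, Real.norm_eq_abs]
    refine ⟨(hM t).trans (by nlinarith [mul_nonneg hM0 (sq_nonneg B)]), ?_⟩
    by_cases h : t ∈ Icc a B
    · have : t ^ 2 ≤ 1 + B ^ 2 := by nlinarith [h.2]
      exact mul_le_mul (hM t) this (sq_nonneg t) hM0
    · rw [(hV.iterate_eulerOp k).eq_zero t h, abs_zero, zero_mul]; positivity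

lemma integral_mul_eulerOp (hV : IsTest a B V) :
    ∫ t, t * _root_.eulerOp V t = -2 * ∫ t, t * V t := by
  have h := integral_mul_deriv_eq_deriv_mul_of_integrable (u := fun t : ℝ => t ^ 2)
    (u' := fun t => 2 * t) (v := V) (v' := deriv V)
    (fun t _ => by simpa using hasDerivAt_pow 2 t)
    (fun t _ => (hV.differentiable t).hasDerivAt)
    (((continuous_pow 2).mul hV.contDiff_deriv.continuous).integrable_of_hasCompactSupport
      hV.hasCompactSupport.deriv.mul_left)
    (((continuous_const.mul continuous_id).mul
      hV.smooth.continuous).integrable_of_hasCompactSupport hV.hasCompactSupport.mul_left)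
    (((continuous_pow 2).mul hV.smooth.continuous).integrable_of_hasCompactSupport
      hV.hasCompactSupport.mul_left)
  rw [← integral_const_mul]
  calc ∫ t, t * _root_.eulerOp V t = ∫ t, t ^ 2 * deriv V t := by
        congr 1; ext t; simp only [_root_.eulerOp]; ring
    _ = - ∫ t, 2 * t * V t := h
    _ = _ := by rw [← integral_neg]; congr 1; ext t; ring

end IsTest

/-- The error term in comparing `∑ m V(m u)` with the integral `u⁻² ∫ t V(t) dt`. -/
noncomputable def riemannError (V : ℝ → ℝ) (u : ℝ) : ℝ :=
  (∑' m : ℕ, m * V (m * u)) - (∫ t, t * V t) / u ^ 2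

namespace IsTest

variable {a B : ℝ} {V : ℝ → ℝ}

lemma tsum_eq_sum (hV : IsTest a B V) {u : ℝ} {N : ℕ} (hu : 0 < u) (h : B < N * u) :
    ∑' m : ℕ, m * V (m * u) = ∑ m ∈ Finset.range N, m * V (m * u) := by
  refine _root_.tsum_eq_sum fun m hm => ?_
  have hm : (N : ℝ) ≤ m := by simpa using hm
  rw [hV.eq_zero, mul_zero]
  intro h'
  exact (h.trans_le (mul_le_mul_of_nonneg_right hm hu.le)).not_ge h'.2

lemma hasDerivAt_riemannError (hV : IsTest a B V) {u : ℝ} (hu : 0 < u) :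
    HasDerivAt (riemannError V) (riemannError (_root_.eulerOp V) u / u) u := by
  obtain ⟨N, hN⟩ := exists_nat_gt (B / (u / 2))
  have hN : B < N * (u / 2) := (div_lt_iff₀ (by positivity)).1 hN
  have hN' : ∀ x, u / 2 ≤ x → B < N * x := fun x hx => hN.trans_le (by gcongr)
  have e : riemannError V =ᶠ[𝓝 u] fun x =>
      (∑ m ∈ Finset.range N, m * V (m * x)) - (∫ t, t * V t) / x ^ 2 := by
    filter_upwards [Ioi_mem_nhds (show u / 2 < u by linarith)] with x hx
    have hx : u / 2 < x := hx
    rw [riemannError, hV.tsum_eq_sum (by linarith) (hN' x hx.le)]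
  refine HasDerivAt.congr_of_eventuallyEq ?_ e
  rw [riemannError, hV.eulerOp.tsum_eq_sum hu (hN' u (by linarith)), hV.integral_mul_eulerOp]
  have h1 : HasDerivAt (fun x => ∑ m ∈ Finset.range N, (m : ℝ) * V (m * x))
      (∑ m ∈ Finset.range N, (m : ℝ) * (deriv V (m * u) * m)) u := by
    refine HasDerivAt.fun_sum fun m _ => HasDerivAt.const_mul _ ?_
    have := (hV.differentiable (m * u)).hasDerivAt.comp u ((hasDerivAt_id u).const_mul (m : ℝ))
    simpa [Function.comp_def] using this
  have h2 := ((hasDerivAt_pow 2 u).inv (by positivity)).const_mul (∫ t, t * V t)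
  refine (h1.sub h2).congr_deriv ?_
  rw [sub_div, Finset.sum_div]
  congr 1
  · refine Finset.sum_congr rfl fun m _ => ?_
    simp only [_root_.eulerOp]; field_simp
  · simp; field_simp

lemma exists_iteratedDerivWithin_bound {f : ℝ → ℝ} (hf : ContDiff ℝ 2 f)
    (hc : HasCompactSupport f) :
    ∃ M, ∀ b, 0 < b → ∀ x, |iteratedDerivWithin 2 f (Icc 0 b) x| ≤ M := by
  have h2 : iteratedDeriv 2 f = deriv (deriv f) := by simp [iteratedDeriv_succ]
  obtain ⟨M, hM⟩ := (hf.continuous_iteratedDeriv 2 le_rfl).bounded_above_of_compact_support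
    (by rw [h2]; exact hc.deriv.deriv)
  refine ⟨M, fun b hb x => ?_⟩
  by_cases hx : x ∈ Icc 0 b
  · rw [iteratedDerivWithin_eq_iteratedDeriv (uniqueDiffOn_Icc hb) hf.contDiffAt hx]
    exact hM x
  · rw [iteratedDerivWithin_succ, derivWithin_zero_of_notMem_closure (by rwa [closure_Icc]),
      abs_zero]
    exact (norm_nonneg _).trans (hM 0)

lemma riemannError_bound_small (hV : IsTest a B V) (ha : 0 < a) (hB : 0 < B) :
    ∃ M, 0 ≤ M ∧ ∀ u, 0 < u → |riemannError V u| ≤ (B + 2 * u) * M := by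
  set f : ℝ → ℝ := fun t => t * V t with hfdef
  have hf : ContDiff ℝ 2 f := contDiff_id.mul (by exact_mod_cast contDiff_infty.1 hV.smooth 2)
  have hfc : HasCompactSupport f := hV.hasCompactSupport.mul_left
  have hf0 : ∀ t, t ∉ Icc a B → f t = 0 := fun t ht => by simp [hfdef, hV.eq_zero t ht]
  obtain ⟨M, hM⟩ := exists_iteratedDerivWithin_bound hf hfc
  have hM0 : 0 ≤ M := (abs_nonneg _).trans (hM 1 one_pos 0)
  refine ⟨M, hM0, fun u hu => ?_⟩
  set N : ℕ := ⌈B / u⌉₊ + 1 with hNdef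
  have hN1 : B < N * u := by
    rw [← div_lt_iff₀ hu, hNdef]; push_cast
    linarith [Nat.le_ceil (B / u)]
  have hN2 : N * u ≤ B + 2 * u := by
    have := (Nat.ceil_lt_add_one (show 0 ≤ B / u by positivity)).le
    have h2 : (N : ℝ) ≤ B / u + 2 := by rw [hNdef]; push_cast; linarith
    calc N * u ≤ (B / u + 2) * u := by gcongr
      _ = _ := by field_simp
  have hNu : 0 < N * u := hB.trans hN1
  have hNpos : (0 : ℝ) < N := by positivity
  have T := trapezoidal_error_le_of_c2 (f := f) (a := 0) (b := N * u) (ζ := M) (N := N)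
    hf.contDiffOn (by rw [uIcc_of_le hNu.le]; exact hM _ hNu) (by omega)
  have e1 : trapezoidal_integral f N 0 (N * u) = u ^ 2 * ∑' m : ℕ, m * V (m * u) := by
    have hz : f 0 = 0 := by simp [hfdef]
    have hb : f (N * u) = 0 := hf0 _ fun h => hN1.not_ge h.2
    have hr : N - 1 + 1 = N := by omega
    have hsum : ∑ m ∈ Finset.range N, (m : ℝ) * V (m * u) =
        ∑ k ∈ Finset.range (N - 1), ((k + 1 : ℕ) : ℝ) * V ((k + 1 : ℕ) * u) := by
      conv_lhs => rw [← hr, Finset.sum_range_succ']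
      simp
    rw [trapezoidal_integral, hV.tsum_eq_sum hu hN1, hz, hb, hsum, sub_zero,
      mul_div_cancel_left₀ _ hNpos.ne', add_zero, zero_div, zero_add, Finset.mul_sum,
      Finset.mul_sum]
    refine Finset.sum_congr rfl fun k _ => ?_
    have : ((k : ℝ) + 1) * (N * u) / N = (k + 1) * u := by field_simp
    rw [this, zero_add]; simp only [hfdef]; push_cast; ring
  have e2 : ∫ x in (0 : ℝ)..(N * u), f x = ∫ t, t * V t := by
    rw [intervalIntegral.integral_of_le hNu.le]
    refine setIntegral_eq_integral_of_forall_compl_eq_zero fun x hx => hf0 x fun h => hx ?_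
    exact ⟨ha.trans_le h.1, h.2.trans hN1.le⟩
  rw [trapezoidal_error, e1, e2, sub_zero, abs_of_pos hNu] at T
  have e3 : u ^ 2 * ∑' m : ℕ, m * V (m * u) - ∫ t, t * V t = u ^ 2 * riemannError V u := by
    rw [riemannError]; field_simp
  rw [e3, abs_mul, abs_of_pos (by positivity : 0 < u ^ 2)] at T
  have e4 : (N * u) ^ 3 * M / (12 * N ^ 2) = u ^ 2 * ((N * u) * M / 12) := by field_simp
  rw [e4] at T
  have T' := le_of_mul_le_mul_left T (by positivity)
  refine T'.trans ?_
  have : N * u * M ≤ (B + 2 * u) * M := by gcongr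
  have h0 : 0 ≤ (B + 2 * u) * M := by positivity
  linarith

lemma riemannError_of_lt (hV : IsTest a B V) {u : ℝ} (hu : 0 < u) (h : B < u) :
    riemannError V u = -(∫ t, t * V t) / u ^ 2 := by
  rw [riemannError, hV.tsum_eq_sum (N := 1) hu (by simpa)]
  simp [neg_div]

lemma riemannError_bound (hV : IsTest a B V) (ha : 0 < a) (hB : 0 < B) :
    ∃ C, ∀ u, 0 < u → |riemannError V u| ≤ C ∧ |riemannError V u| * u ^ 2 ≤ C := by
  obtain ⟨M, hM0, hM⟩ := hV.riemannError_bound_small ha hB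
  set J : ℝ := |∫ t, t * V t|
  have hJ : 0 ≤ J := abs_nonneg _
  refine ⟨(B + 2 * (B + 1)) * M * (1 + (B + 1) ^ 2) + J, fun u hu => ?_⟩
  have hP : 0 ≤ (B + 2 * (B + 1)) * M := by positivity
  rcases le_or_gt u (B + 1) with h | h
  · have h1 : |riemannError V u| ≤ (B + 2 * (B + 1)) * M := (hM u hu).trans (by gcongr)
    constructor
    · nlinarith [mul_nonneg hP (sq_nonneg (B + 1))]
    · have h2 : u ^ 2 ≤ 1 + (B + 1) ^ 2 := by nlinarith
      have := mul_le_mul h1 h2 (sq_nonneg u) hP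
      linarith
  · have e : |riemannError V u| = J / u ^ 2 := by
      rw [hV.riemannError_of_lt hu (by linarith), abs_div, abs_neg, abs_of_pos (by positivity : 0 < u ^ 2)]
    have hQ : 0 ≤ (B + 2 * (B + 1)) * M * (1 + (B + 1) ^ 2) := by positivity
    rw [e]
    constructor
    · have : J / u ^ 2 ≤ J := div_le_self hJ (by nlinarith)
      linarith
    · rw [div_mul_cancel₀ _ (by positivity)]; linarith

lemma eulerChain_riemannError (hV : IsTest a B V) (ha : 0 < a) (hB : 0 < B) :
    EulerChain (fun k t => ((riemannError (_root_.eulerOp^[k] V) t : ℝ) : ℂ)) where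
  deriv k t ht := by
    have := ((hV.iterate_eulerOp k).hasDerivAt_riemannError ht).ofReal_comp
    rw [Function.iterate_succ_apply']
    exact_mod_cast this
  bound k := by
    simpa only [norm_real, Real.norm_eq_abs] using
      (hV.iterate_eulerOp k).riemannError_bound ha hB

end IsTest

/-- A lower bound for a nonvanishing holomorphic function on a disc, from the Borel-Carathéodory
theorem applied to a branch of its logarithm. -/
lemma norm_inv_le_of_ball {f : ℂ → ℂ} {c z : ℂ} {r R M m : ℝ} (hr : 0 < r) (hrR : r < R)
    (hf : DifferentiableOn ℂ f (Metric.ball c R)) (h0 : ∀ w ∈ Metric.ball c R, f w ≠ 0)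
    (hM : ∀ w ∈ Metric.ball c R, ‖f w‖ ≤ M) (hm : 0 < m) (hmM : m < M) (hc : m ≤ ‖f c‖)
    (hz : dist z c ≤ r) :
    ‖(f z)⁻¹‖ ≤ m⁻¹ * Real.exp (2 * r / (R - r) * Real.log (M / m)) := by
  have hR : 0 < R := hr.trans hrR
  have hcb : c ∈ Metric.ball c R := Metric.mem_ball_self hR
  have hfc := h0 c hcb
  have hd : DifferentiableOn ℂ (fun w => deriv f w / f w) (Metric.ball c R) :=
    (hf.deriv Metric.isOpen_ball).div hf h0
  obtain ⟨h, hh⟩ := hd.isExactOn_ball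
  have hexp : ∀ w ∈ Metric.ball c R, f w = f c * exp (h w - h c) := by
    intro w hw
    have hD : ∀ v ∈ Metric.ball c R, HasDerivAt (fun v => f v * exp (-h v)) 0 v := by
      intro v hv
      have h1 := (hf.differentiableAt (Metric.isOpen_ball.mem_nhds hv)).hasDerivAt
      refine (h1.mul (hh v hv).neg.cexp).congr_deriv ?_
      have := h0 v hv
      field_simp
      ring
    have := Metric.isOpen_ball.is_const_of_deriv_eq_zero (convex_ball c R).isPreconnected
      (fun v hv => (hD v hv).differentiableAt.differentiableWithinAt)
      (fun v hv => (hD v hv).deriv) hw hcb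
    have e : exp (h w - h c) = exp (h w) * exp (-h c) := by rw [← exp_add, sub_eq_add_neg]
    rw [e]
    calc f w = f w * exp (-h w) * exp (h w) := by rw [mul_assoc, ← exp_add]; simp
      _ = _ := by rw [this]; ring
  have hzb : z ∈ Metric.ball c R := Metric.mem_ball.2 (hz.trans_lt hrR)
  have hL : 0 < Real.log (M / m) := Real.log_pos (by rwa [lt_div_iff₀ hm, one_mul])
  have hsub : ∀ w ∈ Metric.ball (0 : ℂ) R, w + c ∈ Metric.ball c R := fun w hw => by
    simpa [dist_eq] using hw
  have BC := borelCaratheodory_zero (f := fun w => h (w + c) - h c) (M := Real.log (M / m))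
    (R := R) (z := z - c) hL ?_ ?_ hR (by simpa [dist_eq] using hzb) (by simp)
  · simp only [sub_add_cancel] at BC
    have hzr : ‖z - c‖ ≤ r := by rwa [dist_eq] at hz
    have BC' : ‖h z - h c‖ ≤ 2 * r / (R - r) * Real.log (M / m) := by
      refine BC.trans ?_
      calc 2 * Real.log (M / m) * ‖z - c‖ / (R - ‖z - c‖)
          ≤ 2 * Real.log (M / m) * r / (R - r) := by
            have : 0 < R - r := by linarith
            gcongr
        _ = _ := by ring
    rw [hexp z hzb, mul_inv, norm_mul, norm_inv, ← exp_neg]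
    refine mul_le_mul (inv_anti₀ hm hc) ?_ (norm_nonneg _) (by positivity)
    rw [norm_exp, Real.exp_le_exp]
    refine (re_le_norm _).trans ?_
    rwa [norm_neg]
  · intro w hw
    refine (DifferentiableAt.sub_const ?_ _).differentiableWithinAt
    exact (hh _ (hsub w hw)).differentiableAt.comp w (differentiableAt_id.add_const c)
  · intro w hw
    have e := hexp _ (hsub w hw)
    change (h (w + c) - h c).re ≤ _
    rw [Real.le_log_iff_exp_le (div_pos (hm.trans hmM) hm), ← norm_exp, le_div_iff₀ hm]
    have h1 := hM _ (hsub w hw)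
    rw [e, norm_mul, mul_comm] at h1
    exact (mul_le_mul_of_nonneg_left hc (norm_nonneg _)).trans h1

/-- The fractional part of `t`, cut off to `t > 1`. -/
noncomputable def fractTail : ℝ → ℂ := (Ioi (1 : ℝ)).indicator fun t => (t : ℂ) - (⌊t⌋₊ : ℂ)

lemma norm_fractTail_le (t : ℝ) : ‖fractTail t‖ ≤ 1 := by
  by_cases h : t ∈ Ioi (1 : ℝ)
  · have h0 : (0 : ℝ) ≤ t := le_trans zero_le_one (le_of_lt h)
    have e : (t : ℂ) - (⌊t⌋₊ : ℂ) = ((t - ⌊t⌋₊ : ℝ) : ℂ) := by push_cast; rfl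
    rw [fractTail, indicator_of_mem h, e, norm_real, Real.norm_eq_abs, abs_le]
    constructor <;> linarith [Nat.floor_le h0, Nat.lt_floor_add_one t]
  · simp [fractTail, indicator_of_notMem h]

lemma measurable_sub_floor : Measurable fun t : ℝ => (t : ℂ) - (⌊t⌋₊ : ℂ) := by
  have : Measurable fun t : ℝ => ((t - (⌊t⌋₊ : ℝ) : ℝ) : ℂ) := by fun_prop
  simpa only [ofReal_sub, ofReal_natCast] using this

lemma measurable_fractTail : Measurable fractTail := by
  exact measurable_sub_floor.indicator measurableSet_Ioi

lemma locallyIntegrable_fractTail : LocallyIntegrable fractTail := by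
  refine (locallyIntegrable_const (1 : ℝ)).mono measurable_fractTail.aestronglyMeasurable ?_
  exact Eventually.of_forall fun t => by simpa using norm_fractTail_le t

lemma fractTail_isBigO_top : fractTail =O[atTop] (fun t : ℝ => t ^ (-(0 : ℝ))) :=
  IsBigO.of_bound 1 (Eventually.of_forall fun t => by simpa using norm_fractTail_le t)

lemma fractTail_isBigO_zero (b : ℝ) : fractTail =O[𝓝[>] 0] (fun t : ℝ => t ^ (-b)) := by
  refine IsBigO.of_bound 1 ?_
  filter_upwards [nhdsWithin_le_nhds (Iio_mem_nhds one_pos)] with t ht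
  have : t ∉ Ioi (1 : ℝ) := not_lt.2 (le_of_lt (mem_Iio.1 ht))
  rw [fractTail, indicator_of_notMem this, norm_zero]
  positivity

lemma differentiableAt_mellin_fractTail {s : ℂ} (hs : s.re < 0) :
    DifferentiableAt ℂ (mellin fractTail) s :=
  mellin_differentiableAt_of_isBigO_rpow (locallyIntegrable_fractTail.locallyIntegrableOn _)
    fractTail_isBigO_top hs (fractTail_isBigO_zero (s.re - 1)) (by linarith)

lemma mellin_fractTail (s : ℂ) : mellin fractTail s =
    ∫ t in Ioi (1 : ℝ), (t : ℂ) ^ (s - 1) * ((t : ℂ) - (⌊t⌋₊ : ℂ)) := by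
  rw [mellin, ← integral_indicator measurableSet_Ioi, ← integral_indicator measurableSet_Ioi]
  congr 1; ext t
  by_cases h : t ∈ Ioi (1 : ℝ)
  · rw [indicator_of_mem h, indicator_of_mem (mem_Ioi.2 (one_pos.trans (mem_Ioi.1 h))),
      fractTail, indicator_of_mem h, smul_eq_mul]
  · rw [indicator_of_notMem h, indicator_apply]
    simp [fractTail, indicator_of_notMem h]

lemma norm_mellin_fractTail_le {s : ℂ} (hs : s.re < 0) : ‖mellin fractTail s‖ ≤ (-s.re)⁻¹ := by
  have hI : IntegrableOn (fun t : ℝ => t ^ (s.re - 1)) (Ioi 1) :=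
    integrableOn_Ioi_rpow_of_lt (by linarith) one_pos
  have : ∫ t in Ioi (1 : ℝ), t ^ (s.re - 1) = (-s.re)⁻¹ := by
    rw [integral_Ioi_rpow_of_lt (by linarith) one_pos]
    simp [neg_div, inv_neg]
  rw [← this, mellin_fractTail]
  refine norm_integral_le_of_norm_le hI ?_
  filter_upwards [ae_restrict_mem measurableSet_Ioi] with t ht
  have h0 : 0 < t := one_pos.trans ht
  have := norm_fractTail_le t
  rw [fractTail, indicator_of_mem ht] at this
  rw [norm_mul, norm_cpow_eq_rpow_re_of_pos h0]
  simpa using mul_le_mul_of_nonneg_left this (Real.rpow_nonneg h0.le (s.re - 1))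

lemma riemannZeta₁_eq_of_one_lt {s : ℂ} (hs : 1 < s.re) :
    riemannZeta₁ s = s - s * (s - 1) * mellin fractTail (-s) := by
  have hs1 : s ≠ 1 := fun h => by simp [h] at hs
  have hs1' : s - 1 ≠ 0 := sub_ne_zero.2 hs1
  have hz := LSeries_eq_mul_integral_of_nonneg (fun _ => (1 : ℝ)) zero_le_one hs
    (by simpa using isBigO_refl _ _) (fun _ => zero_le_one)
  have hone : LSeries (fun _ => ((1 : ℝ) : ℂ)) s = riemannZeta s := by
    rw [← LSeries_one_eq_riemannZeta hs]; simp only [ofReal_one]; rfl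
  rw [hone] at hz
  have hmain : ∫ t in Ioi (1 : ℝ), (t : ℂ) ^ (-s) = -1 / (-s + 1) := by
    rw [integral_Ioi_cpow_of_lt (by simpa using hs) one_pos]; simp
  have hI1 : IntegrableOn (fun t : ℝ => (t : ℂ) ^ (-s)) (Ioi 1) :=
    integrableOn_Ioi_cpow_of_lt (by simpa using hs) one_pos
  have hI2 : IntegrableOn (fun t : ℝ => (t : ℂ) ^ (-s - 1) * ((t : ℂ) - (⌊t⌋₊ : ℂ))) (Ioi 1) := by
    have hI : IntegrableOn (fun t : ℝ => t ^ ((-s).re - 1)) (Ioi 1) :=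
      integrableOn_Ioi_rpow_of_lt (by simp; linarith) one_pos
    refine Integrable.mono' hI ?_ ?_
    · refine AEStronglyMeasurable.mul ?_ ?_
      · exact (integrableOn_Ioi_cpow_of_lt (by simp; linarith) one_pos).aestronglyMeasurable
      · exact measurable_sub_floor.aestronglyMeasurable
    · filter_upwards [ae_restrict_mem measurableSet_Ioi] with t ht
      have h0 : 0 < t := one_pos.trans ht
      have := norm_fractTail_le t
      rw [fractTail, indicator_of_mem ht] at this
      rw [norm_mul, norm_cpow_eq_rpow_re_of_pos h0]
      simpa using mul_le_mul_of_nonneg_left this (Real.rpow_nonneg h0.le ((-s).re - 1))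
  have hsum : ∫ t in Ioi (1 : ℝ), (∑ k ∈ Finset.Icc 1 ⌊t⌋₊, ((1 : ℝ) : ℂ)) * (t : ℂ) ^ (-(s + 1))
      = -1 / (-s + 1) - mellin fractTail (-s) := by
    rw [mellin_fractTail, ← hmain, ← integral_sub hI1 hI2]
    refine setIntegral_congr_fun measurableSet_Ioi fun t (ht : 1 < t) => ?_
    have h0 : (t : ℂ) ≠ 0 := by exact_mod_cast (one_pos.trans ht).ne'
    have e1 : (t : ℂ) ^ (-s) = (t : ℂ) ^ (-s - 1) * t := by
      rw [cpow_sub _ _ h0, cpow_one, div_mul_cancel₀ _ h0]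
    have e2 : -(s + 1) = -s - 1 := by ring
    simp only [ofReal_one, Finset.sum_const, Nat.card_Icc, Nat.add_sub_cancel, nsmul_eq_mul,
      mul_one, e1, e2]
    ring
  rw [hsum, riemannZeta_eq_inv_sub_mul hs1] at hz
  have h3 : -s + 1 ≠ 0 := fun h => hs1' (by linear_combination -h)
  field_simp at hz
  have e : riemannZeta₁ s * (-s + 1) =
      (s - s * (s - 1) * mellin fractTail (-s)) * (-s + 1) := by linear_combination hz
  exact mul_right_cancel₀ h3 e

lemma riemannZeta₁_eq {s : ℂ} (hs : 0 < s.re) :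
    riemannZeta₁ s = s - s * (s - 1) * mellin fractTail (-s) := by
  have hU : IsOpen {z : ℂ | 0 < z.re} := isOpen_lt continuous_const continuous_re
  refine AnalyticOnNhd.eqOn_of_preconnected_of_eventuallyEq (𝕜 := ℂ) (E := ℂ) (F := ℂ) (U := {z : ℂ | 0 < z.re})
    (f := riemannZeta₁) (g := fun s => s - s * (s - 1) * mellin fractTail (-s)) (z₀ := 2)
    ?_ ?_ (convex_halfSpace_re_gt 0).isPreconnected (by simp) ?_ hs
  · exact differentiable_riemannZeta₁.differentiableOn.analyticOnNhd hU
  · refine DifferentiableOn.analyticOnNhd (fun z hz => ?_) hU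
    have hz : 0 < z.re := hz
    have : DifferentiableAt ℂ (fun s => mellin fractTail (-s)) z :=
      (differentiableAt_mellin_fractTail (s := -z) (by simpa)).comp z differentiableAt_id.neg
    exact DifferentiableAt.differentiableWithinAt (by fun_prop)
  · filter_upwards [(isOpen_lt continuous_const continuous_re).mem_nhds
      (show (2 : ℂ) ∈ {z : ℂ | 1 < z.re} by simp)] with z hz using riemannZeta₁_eq_of_one_lt hz

lemma norm_riemannZeta₁_le {s : ℂ} (hs : 1 / 2 ≤ s.re) :
    ‖riemannZeta₁ s‖ ≤ 2 * (1 + ‖s‖) ^ 2 := by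
  have h0 : 0 < s.re := by linarith
  rw [riemannZeta₁_eq h0]
  have h1 : ‖mellin fractTail (-s)‖ ≤ 2 := by
    refine (norm_mellin_fractTail_le (by simpa)).trans ?_
    rw [neg_re, neg_neg]
    calc (s.re)⁻¹ ≤ (1 / 2 : ℝ)⁻¹ := inv_anti₀ (by norm_num) hs
      _ = 2 := by norm_num
  have h2 : ‖s - 1‖ ≤ ‖s‖ + 1 := by simpa using norm_sub_le s 1
  calc ‖s - s * (s - 1) * mellin fractTail (-s)‖
      ≤ ‖s‖ + ‖s‖ * ‖s - 1‖ * ‖mellin fractTail (-s)‖ := by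
        simpa using norm_sub_le s (s * (s - 1) * mellin fractTail (-s))
    _ ≤ ‖s‖ + ‖s‖ * (‖s‖ + 1) * 2 := by gcongr
    _ ≤ _ := by nlinarith [norm_nonneg s]

lemma VI_eq (c : ℝ) (f : ℂ → ℂ) : VI c f = (1 / (2 * Real.pi) : ℂ) * ∫ t : ℝ, f (c + t * I) := by
  have hp : (Real.pi : ℂ) ≠ 0 := by exact_mod_cast Real.pi_ne_zero
  rw [VI, integral_mul_const]
  field_simp

lemma VI_const_mul (c : ℝ) (k : ℂ) (f : ℂ → ℂ) : VI c (fun s => k * f s) = k * VI c f := by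
  rw [VI_eq, VI_eq, integral_const_mul, mul_left_comm]

lemma VI_congr {c : ℝ} {f g : ℂ → ℂ} (h : ∀ s : ℂ, s.re = c → f s = g s) : VI c f = VI c g := by
  rw [VI_eq, VI_eq]
  exact congrArg _ (integral_congr_ae (Eventually.of_forall fun t => h _ (by simp)))

lemma mellinInv_eq_VI (c : ℝ) (f : ℂ → ℂ) (x : ℝ) :
    mellinInv c f x = VI c (fun s => (x : ℂ) ^ (-s) * f s) := by
  rw [VI_eq, mellinInv, real_smul]
  push_cast
  rfl

lemma div_cpow_neg {x : ℝ} (hx : 0 < x) (n : ℕ) (s : ℂ) :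
    (((n / x : ℝ)) : ℂ) ^ (-s) = (x : ℂ) ^ s / (n : ℂ) ^ s := by
  rw [ofReal_div, ofReal_natCast, ← ofReal_natCast, ← ofReal_div,
    div_eq_mul_inv (n : ℝ), ofReal_mul,
    mul_cpow_ofReal_nonneg (Nat.cast_nonneg n) (inv_nonneg.2 hx.le), cpow_neg, cpow_neg,
    ofReal_inv, inv_cpow _ _ (by rw [arg_ofReal_of_nonneg hx.le]; exact Real.pi_pos.ne), inv_inv,
    mul_comm, ofReal_natCast]
  rfl

/-- Mellin inversion, termwise against a Dirichlet series. -/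
lemma EulerChain.VI_LSeries {f : ℕ → ℝ → ℂ} (hf : EulerChain f) {σ : ℝ} (h0 : 0 < σ) (h2 : σ < 2)
    {a : ℕ → ℂ} (ha0 : a 0 = 0) (ha : LSeriesSummable a σ) {x : ℝ} (hx : 0 < x) :
    VI σ (fun s => (x : ℂ) ^ s * LSeries a s * mellin (f 0) s) = ∑' n : ℕ, a n * f 0 (n / x) := by
  have hxc : (x : ℂ) ≠ 0 := by exact_mod_cast hx.ne'
  set F : ℕ → ℝ → ℂ := fun n t =>
    (x : ℂ) ^ (σ + t * I : ℂ) * LSeries.term a (σ + t * I) n * mellin (f 0) (σ + t * I) with hF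
  have hmel : Integrable fun t : ℝ => mellin (f 0) (σ + t * I) := hf.verticalIntegrable h0 h2
  have hnorm : ∀ n t, ‖F n t‖ = x ^ σ * ‖LSeries.term a σ n‖ * ‖mellin (f 0) (σ + t * I)‖ := by
    intro n t
    simp [hF, LSeries.norm_term_eq, norm_cpow_eq_rpow_re_of_pos hx]
  have hint : ∀ n, Integrable (F n) := by
    intro n
    have hm : AEStronglyMeasurable (F n) := by
      refine AEStronglyMeasurable.mul (Continuous.aestronglyMeasurable ?_) hmel.1
      refine Continuous.mul ((continuous_vertical σ).const_cpow (.inl hxc)) ?_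
      rcases eq_or_ne n 0 with rfl | hn
      · simp [continuous_const]
      · simp only [LSeries.term_of_ne_zero hn]
        exact continuous_const.div ((continuous_vertical σ).const_cpow
          (.inl (Nat.cast_ne_zero.2 hn))) fun t => by simp [cpow_eq_zero_iff, hn]
    refine Integrable.mono' (hmel.norm.const_mul (x ^ σ * ‖LSeries.term a σ n‖)) hm ?_
    exact Eventually.of_forall fun t => (hnorm n t).le
  have hsum : Summable fun n => ∫ t, ‖F n t‖ := by
    simp only [hnorm, integral_const_mul]
    exact (ha.norm.mul_left _).mul_right _
  have key := hasSum_integral_of_summable_integral_norm hint hsum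
  have hterm : ∀ n, (1 / (2 * Real.pi) : ℂ) * ∫ t, F n t = a n * f 0 (n / x) := by
    intro n
    rcases eq_or_ne n 0 with rfl | hn
    · simp [hF, ha0]
    · have hnx : 0 < (n : ℝ) / x := div_pos (by exact_mod_cast Nat.pos_of_ne_zero hn) hx
      have e : (1 / (2 * Real.pi) : ℂ) * ∫ t, F n t =
          VI σ (fun s => (x : ℂ) ^ s * LSeries.term a s n * mellin (f 0) s) := by rw [VI_eq]
      rw [e, ← hf.mellinInv_mellin h0 h2 hnx, mellinInv_eq_VI, ← VI_const_mul]
      refine VI_congr fun s _ => ?_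
      rw [LSeries.term_of_ne_zero hn, div_cpow_neg hx]
      ring
  rw [VI_eq, ← tsum_congr hterm, (key.mul_left (1 / (2 * Real.pi) : ℂ)).tsum_eq]
  congr 2
  ext t
  simp only [hF, LSeries, tsum_mul_right, tsum_mul_left]

/-- The Dirichlet convolution `μ * id`, i.e. Euler's totient. -/
noncomputable def moebiusConvId : ℕ → ℂ :=
  LSeries.convolution (fun n => (ArithmeticFunction.moebius n : ℂ)) (fun n => (n : ℂ))

lemma moebiusConvId_zero : moebiusConvId 0 = 0 := by
  simp [moebiusConvId]

lemma term_natCast (s : ℂ) (n : ℕ) :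
    LSeries.term (fun n => (n : ℂ)) s n = LSeries.term 1 (s - 1) n := by
  rcases eq_or_ne n 0 with rfl | hn
  · simp
  · have : (n : ℂ) ≠ 0 := Nat.cast_ne_zero.2 hn
    rw [LSeries.term_of_ne_zero hn, LSeries.term_of_ne_zero hn, cpow_sub _ _ this, cpow_one,
      Pi.one_apply, one_div_div]

lemma LSeriesSummable_natCast {s : ℂ} (hs : 2 < s.re) : LSeriesSummable (fun n => (n : ℂ)) s := by
  have : LSeriesSummable 1 (s - 1) := LSeriesSummable_one_iff.2 (by simp; linarith)
  rw [LSeriesSummable] at this ⊢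
  exact this.congr fun n => (term_natCast s n).symm

lemma LSeries_moebius_eq {s : ℂ} (hs : 1 < s.re) :
    LSeries (fun n => (ArithmeticFunction.moebius n : ℂ)) s = (riemannZeta s)⁻¹ := by
  have := LSeries_one_mul_Lseries_moebius hs
  rw [LSeries_one_eq_riemannZeta hs] at this
  exact eq_inv_of_mul_eq_one_right this

lemma LSeriesSummable_moebiusConvId {s : ℂ} (hs : 2 < s.re) :
    LSeriesSummable moebiusConvId s :=
  (ArithmeticFunction.LSeriesSummable_moebius_iff.2 (by linarith)).convolution
    (LSeriesSummable_natCast hs)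

lemma LSeries_moebiusConvId {s : ℂ} (hs : 2 < s.re) :
    LSeries moebiusConvId s = riemannZeta (s - 1) / riemannZeta s := by
  rw [moebiusConvId, LSeries_convolution' (ArithmeticFunction.LSeriesSummable_moebius_iff.2
    (by linarith)) (LSeriesSummable_natCast hs), LSeries_moebius_eq (by linarith),
    ← LSeries_one_eq_riemannZeta (s := s - 1) (by simp; linarith), div_eq_inv_mul]
  congr 1
  exact tsum_congr fun n => term_natCast s n

/-- The double contour integral as a finite sum of `φ(n) f(n/x)²`. -/
lemma EulerChain.VI_VI {f : ℕ → ℝ → ℂ} (hf : EulerChain f) {B : ℝ}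
    (hB : ∀ t, B < t → f 0 t = 0) {c₁ c₂ : ℝ} (h1 : 1 < c₁) (h1' : c₁ < 2) (h2 : 1 < c₂)
    (h2' : c₂ < 2) {x : ℝ} (hx : 0 < x) :
    VI c₁ (fun s₁ => VI c₂ (fun s₂ => riemannZeta (s₁ + s₂ - 1) / riemannZeta (s₁ + s₂) *
      (x : ℂ) ^ (s₁ + s₂) * mellin (f 0) s₁ * mellin (f 0) s₂)) =
      ∑' n : ℕ, moebiusConvId n * f 0 (n / x) ^ 2 := by
  have hxc : (x : ℂ) ≠ 0 := by exact_mod_cast hx.ne'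
  have hinner : ∀ s₁ : ℂ, s₁.re = c₁ →
      VI c₂ (fun s₂ => riemannZeta (s₁ + s₂ - 1) / riemannZeta (s₁ + s₂) *
        (x : ℂ) ^ (s₁ + s₂) * mellin (f 0) s₁ * mellin (f 0) s₂) =
      (x : ℂ) ^ s₁ * LSeries (fun n => moebiusConvId n * f 0 (n / x)) s₁ * mellin (f 0) s₁ := by
    intro s₁ hs₁
    set a : ℕ → ℂ := fun n => LSeries.term moebiusConvId s₁ n
    have hterm : ∀ (s : ℂ) n, LSeries.term a s n = LSeries.term moebiusConvId (s₁ + s) n := by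
      intro s n
      rcases eq_or_ne n 0 with rfl | hn
      · simp
      · have : (n : ℂ) ≠ 0 := Nat.cast_ne_zero.2 hn
        rw [LSeries.term_of_ne_zero hn, LSeries.term_of_ne_zero hn, cpow_add _ _ this]
        simp only [a, LSeries.term_of_ne_zero hn, div_div]
    have hLS : ∀ s, LSeries a s = LSeries moebiusConvId (s₁ + s) := fun s =>
      tsum_congr (hterm s)
    have hsum : LSeriesSummable a c₂ := by
      have : LSeriesSummable moebiusConvId (s₁ + c₂) :=
        LSeriesSummable_moebiusConvId (by simp [hs₁]; linarith)
      rw [LSeriesSummable] at this ⊢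
      exact this.congr fun n => (hterm c₂ n).symm
    have h := hf.VI_LSeries (by linarith) h2' (by simp [a]) hsum hx
    have e : LSeries (fun n => moebiusConvId n * f 0 (n / x)) s₁ = ∑' n : ℕ, a n * f 0 (n / x) := by
      refine tsum_congr fun n => ?_
      rcases eq_or_ne n 0 with rfl | hn
      · simp [a]
      · simp only [a, LSeries.term_of_ne_zero hn]; ring
    rw [e, ← h, mul_assoc, mul_comm _ (mellin (f 0) s₁), ← mul_assoc, ← VI_const_mul]
    refine VI_congr fun s hs => ?_
    rw [hLS, LSeries_moebiusConvId (by simp [hs₁, hs]; linarith), cpow_add _ _ hxc]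
    ring
  have hsum : LSeriesSummable (fun n => moebiusConvId n * f 0 (n / x)) c₁ := by
    refine summable_of_ne_finset_zero (s := Finset.range (⌊B * x⌋₊ + 1)) fun n hn => ?_
    have hn : B * x < n := by
      have : ⌊B * x⌋₊ < n := by simpa using hn
      exact Nat.lt_of_floor_lt this
    have hn' : B < n / x := by rwa [lt_div_iff₀ hx]
    rw [LSeries.term]
    split_ifs <;> simp [hB _ hn']
  have h := hf.VI_LSeries (by linarith) h1' (by simp [moebiusConvId_zero]) hsum hx
  rw [tsum_congr fun n => show moebiusConvId n * f 0 (n / x) ^ 2 =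
    moebiusConvId n * f 0 (n / x) * f 0 (n / x) by ring, ← h]
  exact VI_congr hinner

lemma hasSum_moebius_mul_inv_sq :
    HasSum (fun d : ℕ => (ArithmeticFunction.moebius d : ℂ) * ((d : ℂ) ^ 2)⁻¹) (riemannZeta 2)⁻¹ := by
  have hs : 1 < (2 : ℂ).re := by simp
  have h := (ArithmeticFunction.LSeriesSummable_moebius_iff.2 hs).LSeriesHasSum
  rw [LSeries_moebius_eq hs, LSeriesHasSum] at h
  refine h.congr_fun fun d => ?_
  rcases eq_or_ne d 0 with rfl | hd
  · simp
  · rw [LSeries.term_of_ne_zero hd, div_eq_mul_inv]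
    norm_cast

lemma IsTest.tsum_moebiusConvId {a B : ℝ} {V : ℝ → ℝ} (hV : IsTest a B V) {x : ℝ}
    (hx : 0 < x) :
    ∑' n : ℕ, moebiusConvId n * (V (n / x) : ℂ) =
      ∑' d : ℕ, (ArithmeticFunction.moebius d : ℂ) * (riemannError V (d / x) : ℂ) +
        (x : ℂ) ^ 2 / riemannZeta 2 * ((∫ t, t * V t : ℝ) : ℂ) := by
  have hxc : (x : ℂ) ≠ 0 := by exact_mod_cast hx.ne'
  obtain ⟨N, hN⟩ := exists_nat_gt (B * x)
  set h : ℕ × ℕ → ℂ := fun p =>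
    (ArithmeticFunction.moebius p.1 : ℂ) * (p.2 * (V ((p.1 * p.2 : ℕ) / x) : ℂ)) with hh
  have hV0 : ∀ n : ℕ, N ≤ n → V (n / x) = 0 := fun n hn => by
    refine hV.eq_zero _ fun h' => ?_
    have h1 : (N : ℝ) ≤ n := by exact_mod_cast hn
    exact (lt_div_iff₀ hx |>.2 (hN.trans_le h1)).not_ge h'.2
  have hsupp : ∀ p ∉ Finset.range N ×ˢ Finset.range N, h p = 0 := by
    rintro ⟨d, m⟩ hp
    rcases Nat.eq_zero_or_pos d with rfl | hd
    · simp [hh]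
    rcases Nat.eq_zero_or_pos m with rfl | hm
    · simp [hh]
    have : N ≤ d * m := by
      by_contra hc
      refine hp (Finset.mem_product.2 ⟨Finset.mem_range.2 ?_, Finset.mem_range.2 ?_⟩)
      · exact (Nat.le_mul_of_pos_right d hm).trans_lt (not_le.1 hc)
      · exact (Nat.le_mul_of_pos_left m hd).trans_lt (not_le.1 hc)
    simp only [hh, hV0 _ this, ofReal_zero, mul_zero]
  have hS : Summable h := summable_of_ne_finset_zero hsupp
  have e1 : ∑' n : ℕ, moebiusConvId n * (V (n / x) : ℂ) = ∑' p, h p := by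
    rw [← (hS.hasSum.tsum_fiberwise (fun p : ℕ × ℕ => p.1 * p.2)).tsum_eq]
    refine tsum_congr fun n => ?_
    rcases eq_or_ne n 0 with rfl | hn
    · rw [moebiusConvId_zero, zero_mul]
      symm
      convert tsum_zero with p
      obtain ⟨⟨d, m⟩, hp⟩ := p
      have hp : d * m = 0 := hp
      rcases Nat.mul_eq_zero.1 hp with rfl | rfl <;> simp [hh]
    · have hset : (fun p : ℕ × ℕ => p.1 * p.2) ⁻¹' {n} = ↑n.divisorsAntidiagonal := by
        ext p; simp [hn]
      rw [hset, Finset.tsum_subtype' n.divisorsAntidiagonal h, moebiusConvId,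
        LSeries.convolution_def, Finset.sum_mul]
      refine Finset.sum_congr rfl fun p hp => ?_
      rw [hh]
      simp only
      rw [(Nat.mem_divisorsAntidiagonal.1 hp).1]
      ring
  have e2 : ∑' p, h p = ∑' d : ℕ, (ArithmeticFunction.moebius d : ℂ) *
      ((∑' m : ℕ, m * V (m * (d / x)) : ℝ) : ℂ) := by
    rw [hS.tsum_prod]
    refine tsum_congr fun d => ?_
    rw [ofReal_tsum, ← tsum_mul_left]
    refine tsum_congr fun m => ?_
    have : ((d * m : ℕ) : ℝ) / x = m * (d / x) := by push_cast; ring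
    simp only [hh, this, ofReal_mul, ofReal_natCast]
  have hI := hasSum_moebius_mul_inv_sq.mul_right ((x : ℂ) ^ 2 * ((∫ t, t * V t : ℝ) : ℂ))
  have hA : Summable fun d : ℕ => (ArithmeticFunction.moebius d : ℂ) *
      ((∑' m : ℕ, m * V (m * (d / x)) : ℝ) : ℂ) := by
    refine summable_of_ne_finset_zero (s := Finset.range N) fun d hd => ?_
    have hd : N ≤ d := by simpa using hd
    have : ∀ m : ℕ, (m : ℝ) * V (m * (d / x)) = 0 := by
      intro m
      rcases Nat.eq_zero_or_pos m with rfl | hm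
      · simp
      have := hV0 (m * d) (hd.trans (Nat.le_mul_of_pos_left d hm))
      rw [Nat.cast_mul, mul_div_assoc] at this
      rw [this, mul_zero]
    simp [this]
  rw [e1, e2, show (x : ℂ) ^ 2 / riemannZeta 2 * ((∫ t, t * V t : ℝ) : ℂ) =
    (riemannZeta 2)⁻¹ * ((x : ℂ) ^ 2 * ((∫ t, t * V t : ℝ) : ℂ)) by ring, ← sub_eq_iff_eq_add,
    ← hI.tsum_eq, ← hA.tsum_sub hI.summable]
  refine tsum_congr fun d => ?_
  rw [riemannError, ofReal_sub, mul_sub]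
  congr 1
  rcases eq_or_ne d 0 with rfl | hd
  · simp
  · push_cast
    field_simp

/-- Shifting a vertical contour across a strip of holomorphy. -/
lemma VI_shift {G : ℂ → ℂ} {a b K : ℝ} (hab : a ≤ b)
    (hG : ∀ s : ℂ, a ≤ s.re → s.re ≤ b → DifferentiableAt ℂ G s)
    (hK : ∀ s : ℂ, a ≤ s.re → s.re ≤ b → ‖G s‖ ≤ K * ((1 + |s.im|) ^ 2)⁻¹) :
    VI a G = VI b G := by
  have hcont : ∀ c, a ≤ c → c ≤ b → Continuous fun t : ℝ => G (c + t * I) := fun c h1 h2 =>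
    continuous_iff_continuousAt.2 fun t => ContinuousAt.comp
      (f := fun t : ℝ => (c + t * I : ℂ)) (g := G)
      (hG _ (by simpa) (by simpa)).continuousAt (continuous_vertical c).continuousAt
  have hint : ∀ c, a ≤ c → c ≤ b → Integrable fun t : ℝ => G (c + t * I) := fun c h1 h2 =>
    (integrable_one_add_abs_sq_inv.const_mul K).mono' (hcont c h1 h2).aestronglyMeasurable
      (Eventually.of_forall fun t => by simpa using hK (c + t * I) (by simpa) (by simpa))
  have hlim : ∀ c, a ≤ c → c ≤ b → Tendsto (fun T : ℝ => ∫ t in (-T)..T, G (c + t * I)) atTop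
      (𝓝 (∫ t : ℝ, G (c + t * I))) := fun c h1 h2 =>
    intervalIntegral_tendsto_integral (hint c h1 h2) tendsto_neg_atTop_atBot tendsto_id
  have hhor : ∀ σ : ℝ, |σ| = 1 → Tendsto (fun T : ℝ => ∫ u in a..b, G (u + (σ * T : ℝ) * I)) atTop
      (𝓝 0) := by
    intro σ hσ
    have h0 : Tendsto (fun T : ℝ => K * ((1 + |T|) ^ 2)⁻¹ * |b - a|) atTop (𝓝 0) := by
      have : Tendsto (fun T : ℝ => ((1 + |T|) ^ 2)⁻¹) atTop (𝓝 0) :=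
        tendsto_inv_atTop_zero.comp ((tendsto_pow_atTop two_ne_zero).comp
          (tendsto_atTop_add_const_left _ _ tendsto_abs_atTop_atTop))
      simpa using (this.const_mul K).mul_const |b - a|
    refine squeeze_zero_norm (fun T => ?_) h0
    refine intervalIntegral.norm_integral_le_of_norm_le_const fun u hu => ?_
    rw [uIoc_of_le hab] at hu
    have := hK (u + (σ * T : ℝ) * I) (by simpa using hu.1.le) (by simpa using hu.2)
    simpa [abs_mul, hσ] using this
  have hrect : ∀ T : ℝ, ((∫ u in a..b, G (u + ((-1) * T : ℝ) * I)) -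
      (∫ u in a..b, G (u + (1 * T : ℝ) * I)) + I • ∫ t in (-T)..T, G (b + t * I)) -
        I • ∫ t in (-T)..T, G (a + t * I) = 0 := by
    intro T
    have := integral_boundary_rect_eq_zero_of_differentiableOn G (a + (-T : ℝ) * I)
      (b + (T : ℝ) * I) fun s hs => ?_
    · simpa using this
    · have h1 : s.re ∈ uIcc a b := by simpa using hs.1
      rw [uIcc_of_le hab] at h1
      exact (hG s h1.1 h1.2).differentiableWithinAt
  have hL := (((hhor (-1) (by simp)).sub (hhor 1 (by simp))).add
    ((hlim b hab le_rfl).const_smul I)).sub ((hlim a le_rfl hab).const_smul I)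
  have := tendsto_nhds_unique (hL.congr hrect) tendsto_const_nhds
  rw [VI_eq, VI_eq]
  congr 1
  have h2 : I * ((∫ t : ℝ, G (b + t * I)) - ∫ t : ℝ, G (a + t * I)) = 0 := by
    simpa [mul_sub] using this
  exact (sub_eq_zero.1 ((mul_eq_zero.1 h2).resolve_left I_ne_zero)).symm

lemma RiemannHypothesis.riemannZeta₁_ne_zero (hRH : RiemannHypothesis) {s : ℂ}
    (hs : 1 / 2 < s.re) : riemannZeta₁ s ≠ 0 := by
  rcases eq_or_ne s 1 with rfl | h1
  · simp
  · intro h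
    have hz : riemannZeta s = 0 := by rw [riemannZeta_eq_inv_sub_mul h1, h, mul_zero]
    have := hRH s hz (by
      rintro ⟨n, rfl⟩
      have : ((-2 * (n + 1) : ℂ)).re = -2 * (n + 1) := by simp
      rw [this] at hs
      have : (0 : ℝ) ≤ n := n.cast_nonneg
      linarith) h1
    linarith

lemma exists_le_norm_riemannZeta₁ :
    ∃ m : ℝ, 0 < m ∧ m ≤ 1 ∧ ∀ t : ℝ, m ≤ ‖riemannZeta₁ (2 + t * I)‖ := by
  have hs : 1 < (2 : ℂ).re := by simp
  have hsum := (ArithmeticFunction.LSeriesSummable_moebius_iff.2 hs).norm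
  set A := ∑' n, ‖LSeries.term (fun n => (ArithmeticFunction.moebius n : ℂ)) 2 n‖
  have hA : 0 ≤ A := tsum_nonneg fun n => norm_nonneg _
  refine ⟨(A + 1)⁻¹, by positivity, inv_le_one_of_one_le₀ (by linarith), fun t => ?_⟩
  have hre : (2 + t * I : ℂ).re = 2 := by simp
  have hne : (2 + t * I : ℂ) ≠ 1 := fun h => by simp [h] at hre
  have hterm : ∀ n, ‖LSeries.term (fun n => (ArithmeticFunction.moebius n : ℂ)) (2 + t * I) n‖ =
      ‖LSeries.term (fun n => (ArithmeticFunction.moebius n : ℂ)) 2 n‖ := fun n => by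
    rw [LSeries.norm_term_eq, LSeries.norm_term_eq, hre]; simp
  have hinv : ‖(riemannZeta (2 + t * I))⁻¹‖ ≤ A := by
    rw [← LSeries_moebius_eq (by rw [hre]; norm_num), LSeries]
    refine (norm_tsum_le_tsum_norm ?_).trans_eq (tsum_congr hterm)
    exact hsum.congr fun n => (hterm n).symm
  have hz0 : riemannZeta (2 + t * I) ≠ 0 := riemannZeta_ne_zero_of_one_lt_re (by rw [hre]; norm_num)
  have h1 : 1 ≤ ‖(2 + t * I : ℂ) - 1‖ := by
    have := abs_re_le_norm ((2 + t * I : ℂ) - 1)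
    rw [sub_re, hre] at this
    norm_num at this
    exact this
  have hz : (A + 1)⁻¹ ≤ ‖riemannZeta (2 + t * I)‖ := by
    rw [norm_inv] at hinv
    rw [← inv_inv ‖riemannZeta _‖]
    exact inv_anti₀ (inv_pos.2 (norm_pos_iff.2 hz0)) (by linarith)
  have e : riemannZeta₁ (2 + t * I) = ((2 + t * I) - 1) * riemannZeta (2 + t * I) := by
    rw [riemannZeta_eq_inv_sub_mul hne, mul_inv_cancel_left₀ (sub_ne_zero.2 hne)]
  rw [e, norm_mul]
  nlinarith [norm_nonneg (riemannZeta (2 + t * I))]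

lemma RiemannHypothesis.exists_norm_inv_le (hRH : RiemannHypothesis) {δ : ℝ} (h0 : 0 < δ)
    (h1 : δ < 1) : ∃ C : ℝ, 0 < C ∧ ∃ k : ℕ, ∀ s : ℂ, 1 / 2 + δ ≤ s.re → s.re ≤ 3 / 2 →
      ‖(riemannZeta₁ s)⁻¹‖ ≤ C * (1 + |s.im|) ^ k := by
  obtain ⟨m, hm, hm1, hmt⟩ := exists_le_norm_riemannZeta₁
  set κ := 2 * (3 / 2 - δ) / ((3 / 2 - δ / 2) - (3 / 2 - δ)) with hκ
  refine ⟨m⁻¹ * (50 / m) ^ ⌈κ⌉₊, by positivity, 2 * ⌈κ⌉₊, fun s hs1 hs2 => ?_⟩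
  set t := s.im
  have ht := abs_nonneg t
  set M := 50 * (1 + |t|) ^ 2 with hM
  have hmM : m < M := by rw [hM]; nlinarith
  have hre : ∀ w ∈ Metric.ball (2 + t * I : ℂ) (3 / 2 - δ / 2), 1 / 2 < w.re := by
    intro w hw
    have h := (abs_re_le_norm (w - (2 + t * I))).trans_lt (by rwa [← dist_eq])
    have h := (abs_lt.1 h).1
    simp at h
    linarith
  have key := norm_inv_le_of_ball (f := riemannZeta₁) (c := 2 + t * I) (z := s) (r := 3 / 2 - δ)
    (R := 3 / 2 - δ / 2) (M := M) (m := m) (by linarith) (by linarith)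
    differentiable_riemannZeta₁.differentiableOn
    (fun w hw => hRH.riemannZeta₁_ne_zero (hre w hw)) (fun w hw => ?_) hm hmM (hmt t) ?_
  · refine key.trans ?_
    rw [← hκ]
    have hMm : 1 ≤ M / m := by rw [one_le_div hm]; exact hmM.le
    have hlog := Real.log_nonneg hMm
    have hpos : 0 < M / m := by linarith
    calc m⁻¹ * Real.exp (κ * Real.log (M / m))
        ≤ m⁻¹ * Real.exp (⌈κ⌉₊ * Real.log (M / m)) := by
          gcongr; exact Nat.le_ceil κ
      _ = m⁻¹ * (M / m) ^ ⌈κ⌉₊ := by rw [Real.exp_nat_mul, Real.exp_log hpos]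
      _ = _ := by rw [hM, pow_mul, mul_assoc, ← mul_pow]; congr 2; ring
  · refine (norm_riemannZeta₁_le (hre w hw).le).trans ?_
    have h2 : ‖w‖ ≤ 7 / 2 + |t| := by
      have h3 : ‖w - (2 + t * I)‖ < 3 / 2 - δ / 2 := by rwa [← dist_eq]
      have h4 : ‖(2 + t * I : ℂ)‖ ≤ 2 + |t| := by
        simpa using norm_add_le (2 : ℂ) (t * I)
      have h5 : ‖w‖ ≤ ‖w - (2 + t * I)‖ + ‖(2 + t * I : ℂ)‖ := norm_le_norm_sub_add _ _
      linarith
    have h6 : 1 + ‖w‖ ≤ 5 * (1 + |t|) := by linarith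
    rw [hM]
    nlinarith [norm_nonneg w]
  · have e : s - (2 + t * I) = ((s.re - 2 : ℝ) : ℂ) := by
      apply Complex.ext <;> simp [t]
    rw [dist_eq, e, norm_real, Real.norm_eq_abs, abs_le]
    constructor <;> linarith

/-- Under RH, `∑ μ(d) f(d/x) ≪ x^{1/2+δ}` when `f` has a rapidly decaying Mellin transform in the
strip `0 < Re s < 2`. -/
lemma RiemannHypothesis.exists_norm_tsum_moebius_le (hRH : RiemannHypothesis) {f : ℕ → ℝ → ℂ}
    (hf : EulerChain f) {δ : ℝ} (h0 : 0 < δ) (h1 : δ < 1) :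
    ∃ C : ℝ, 0 < C ∧ ∀ x : ℝ, 1 ≤ x →
      ‖∑' d : ℕ, (ArithmeticFunction.moebius d : ℂ) * f 0 (d / x)‖ ≤ C * x ^ (1 / 2 + δ) := by
  obtain ⟨C, hC, k, hCk⟩ := hRH.exists_norm_inv_le h0 h1
  obtain ⟨K, hK, hKk⟩ := hf.exists_decay (k + 3) (a := 1 / 2) (b := 3 / 2) (by norm_num)
    (by norm_num)
  set J := ∫ t : ℝ, ((1 + |t|) ^ 2)⁻¹
  have hJ : 0 ≤ J := integral_nonneg fun t => by positivity
  refine ⟨C * K * J + 1, by positivity, fun x hx => ?_⟩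
  have hx0 : 0 < x := by linarith
  have hxc : (x : ℂ) ≠ 0 := by exact_mod_cast hx0.ne'
  set G : ℂ → ℂ := fun s => (x : ℂ) ^ s * ((s - 1) * (riemannZeta₁ s)⁻¹) * mellin (f 0) s with hGdef
  have hbound : ∀ s : ℂ, 1 / 2 + δ ≤ s.re → s.re ≤ 3 / 2 →
      ‖G s‖ ≤ C * K * x ^ s.re * ((1 + |s.im|) ^ 2)⁻¹ := by
    intro s hs1 hs2
    have hT : 0 < 1 + |s.im| := by positivity
    have hsm : ‖s - 1‖ ≤ 1 + |s.im| := by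
      refine (norm_le_abs_re_add_abs_im (s - 1)).trans ?_
      rw [sub_re, sub_im, one_re, one_im, sub_zero]
      have : |s.re - 1| ≤ 1 := abs_le.2 ⟨by linarith, by linarith⟩
      linarith
    simp only [hGdef, norm_mul, norm_cpow_eq_rpow_re_of_pos hx0]
    calc x ^ s.re * (‖s - 1‖ * ‖(riemannZeta₁ s)⁻¹‖) * ‖mellin (f 0) s‖
        ≤ x ^ s.re * ((1 + |s.im|) * (C * (1 + |s.im|) ^ k)) *
            (K * ((1 + |s.im|) ^ (k + 3))⁻¹) := by
          gcongr
          · exact hCk s hs1 hs2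
          · exact hKk s (by linarith) hs2
      _ = _ := by field_simp; ring
  have hdiff : ∀ s : ℂ, 1 / 2 + δ ≤ s.re → s.re ≤ 3 / 2 → DifferentiableAt ℂ G s := by
    intro s hs1 hs2
    have hne := hRH.riemannZeta₁_ne_zero (s := s) (by linarith)
    have hz : DifferentiableAt ℂ riemannZeta₁ s := differentiable_riemannZeta₁ s
    have hm : DifferentiableAt ℂ (mellin (f 0)) s :=
      (hf.stripDecay 0).differentiableAt_mellin (by linarith) (by linarith)
    have hp : DifferentiableAt ℂ (fun s : ℂ => (x : ℂ) ^ s) s :=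
      differentiableAt_id.const_cpow (.inl hxc)
    exact (hp.mul ((differentiableAt_id.sub_const 1).mul (hz.inv hne))).mul hm
  have hshift := VI_shift (G := G) (a := 1 / 2 + δ) (b := 3 / 2) (K := C * K * x ^ (3 / 2 : ℝ))
    (by linarith) hdiff fun s hs1 hs2 => (hbound s hs1 hs2).trans (by gcongr)
  have hre : ((3 / 2 : ℝ) : ℂ).re = 3 / 2 := ofReal_re _
  have hL := hf.VI_LSeries (σ := 3 / 2) (by norm_num) (by norm_num) (by simp)
    (ArithmeticFunction.LSeriesSummable_moebius_iff.2 (by rw [hre]; norm_num)) hx0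
  have hG : VI (3 / 2 : ℝ) G = VI (3 / 2 : ℝ) (fun s => (x : ℂ) ^ s *
      LSeries (fun n => (ArithmeticFunction.moebius n : ℂ)) s * mellin (f 0) s) := by
    refine VI_congr fun s hs => ?_
    have hs1 : s ≠ 1 := fun h => by norm_num [h] at hs
    rw [LSeries_moebius_eq (by rw [hs]; norm_num), riemannZeta_eq_inv_sub_mul hs1, mul_inv, inv_inv]
  rw [← hL, ← hG, ← hshift, VI_eq, norm_mul]
  have hpi : ‖(1 / (2 * Real.pi) : ℂ)‖ ≤ 1 := by
    rw [norm_div, norm_mul, norm_real, Real.norm_of_nonneg Real.pi_pos.le, norm_one,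
      Complex.norm_ofNat, div_le_one (by positivity)]
    linarith [Real.pi_gt_three]
  have hint : ‖∫ t : ℝ, G ((1 / 2 + δ : ℝ) + t * I)‖ ≤ C * K * x ^ (1 / 2 + δ) * J := by
    rw [← integral_const_mul]
    refine norm_integral_le_of_norm_le (integrable_one_add_abs_sq_inv.const_mul _)
      (Eventually.of_forall fun t => ?_)
    have hre' : ((1 / 2 + δ : ℝ) + t * I : ℂ).re = 1 / 2 + δ := by
      rw [add_re, ofReal_re]; simp
    have him : ((1 / 2 + δ : ℝ) + t * I : ℂ).im = t := by
      rw [add_im, ofReal_im]; simp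
    have := hbound ((1 / 2 + δ : ℝ) + t * I) hre'.ge (by rw [hre']; linarith)
    rwa [hre', him] at this
  calc _ ≤ 1 * (C * K * x ^ (1 / 2 + δ) * J) :=
        mul_le_mul hpi hint (norm_nonneg _) zero_le_one
    _ ≤ _ := by
        have := Real.rpow_nonneg hx0.le (1 / 2 + δ)
        linarith

/-- Parseval's formula for the Mellin transform on the line `Re s = c`, paired with `2 - s`. -/
lemma EulerChain.VI_parseval {f : ℕ → ℝ → ℂ} (hf : EulerChain f) {c : ℝ} (h0 : 0 < c)
    (h2 : c < 2) :
    VI c (fun s => mellin (f 0) (2 - s) * mellin (f 0) s) =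
      ∫ u in Ioi (0 : ℝ), (u : ℂ) * f 0 u ^ 2 := by
  have hB : Integrable fun t : ℝ => mellin (f 0) (c + t * I) := hf.verticalIntegrable h0 h2
  have hA : Integrable (fun u : ℝ => (u : ℂ) ^ ((2 - c : ℂ) - 1) * f 0 u)
      (volume.restrict (Ioi 0)) :=
    (hf.stripDecay 0).mellinConvergent (s := 2 - c) (by simpa) (by simpa)
  set Φ : ℝ → ℝ → ℂ := fun t u =>
    (u : ℂ) ^ (-(t * I)) * (mellin (f 0) (c + t * I) * ((u : ℂ) ^ ((2 - c : ℂ) - 1) * f 0 u))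
    with hΦ
  have hpos : ∀ᵐ p : ℝ × ℝ ∂(volume.prod (volume.restrict (Ioi 0))), 0 < p.2 :=
    Measure.quasiMeasurePreserving_snd.ae (ae_restrict_mem measurableSet_Ioi)
  have hint : Integrable (Function.uncurry Φ) (volume.prod (volume.restrict (Ioi 0))) := by
    have hAB := hB.mul_prod hA
    refine hAB.mono ?_ ?_
    · refine AEStronglyMeasurable.mul ?_ hAB.aestronglyMeasurable
      have : Measurable fun p : ℝ × ℝ => (p.2 : ℂ) ^ (-(p.1 * I)) := by fun_prop
      exact this.aestronglyMeasurable
    · filter_upwards [hpos] with p hp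
      simp [Function.uncurry, hΦ, norm_cpow_eq_rpow_re_of_pos hp]
  have hpow : ∀ (t : ℝ) {u : ℝ}, 0 < u → (u : ℂ) ^ (-(t * I)) * (u : ℂ) ^ ((2 - c : ℂ) - 1) =
      (u : ℂ) ^ ((2 - (c + t * I)) - 1 : ℂ) := by
    intro t u hu
    rw [← cpow_add _ _ (by exact_mod_cast hu.ne')]
    congr 1
    ring
  have e1 : ∀ t : ℝ, mellin (f 0) (2 - (c + t * I)) * mellin (f 0) (c + t * I) =
      ∫ u in Ioi (0 : ℝ), Φ t u := by
    intro t
    rw [mellin, ← integral_mul_const]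
    refine setIntegral_congr_fun measurableSet_Ioi fun u hu => ?_
    simp only [hΦ, smul_eq_mul, ← hpow t hu]
    ring
  rw [VI_eq]
  simp only [e1]
  rw [integral_integral_swap hint, ← integral_const_mul]
  refine setIntegral_congr_fun measurableSet_Ioi fun u hu => ?_
  have hu : 0 < u := hu
  have huc : (u : ℂ) ≠ 0 := by exact_mod_cast hu.ne'
  have hinv := hf.mellinInv_mellin h0 h2 hu
  rw [mellinInv_eq_VI] at hinv
  have : VI c (fun s => (u * f 0 u) * ((u : ℂ) ^ (-s) * mellin (f 0) s)) = u * f 0 u ^ 2 := by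
    rw [VI_const_mul, hinv]; ring
  rw [← this, VI_eq]
  congr 2
  ext t
  rw [hΦ]
  have e2 : (u : ℂ) ^ (-(t * I)) * (u : ℂ) ^ ((2 - c : ℂ) - 1) = u * (u : ℂ) ^ (-(c + t * I)) := by
    rw [hpow t hu, show ((2 - (c + t * I)) - 1 : ℂ) = 1 + -(c + t * I) by ring,
      cpow_add _ _ huc, cpow_one]
  linear_combination (mellin (f 0) (c + t * I) * f 0 u) * e2

lemma mellinW_eq (W : ℝ → ℝ) (s : ℂ) : mellinW W s = mellin (fun t => (W t : ℂ)) s := by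
  simp [mellinW, mellin, mul_comm]

lemma Weight.isTest {U : ℝ} (W : Weight U) :
    IsTest (1 / (2 * U)) (1 + 1 / (2 * U)) W.toFun :=
  ⟨W.smooth, W.support_subset⟩

end

open MeasureTheory Set

/-- Under RH, evaluation of the term `C₁` with error `O(y x^{1/2+ε})`. -/
theorem C1_evaluation (hRH : RiemannHypothesis) (ε : ℝ) (hε : 0 < ε)
    (U : ℝ) (hU : 2 ≤ U) (W : Weight U)
    (c₁ c₂ : ℝ) (h1 : 1 < c₁) (h12 : c₁ < c₂) (h2 : c₂ < 2) :
    ∃ C : ℝ, 0 < C ∧ ∃ X : ℝ, ∀ x y : ℝ, X ≤ x → X ≤ y →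
      ‖VI c₁ (fun s₁ => VI c₂ (fun s₂ =>
            riemannZeta (s₁ + s₂ - 1) / riemannZeta (s₁ + s₂) * (y : ℂ) * mellinW W.toFun 1 *
              (x : ℂ) ^ (s₁ + s₂) * mellinW W.toFun s₁ * mellinW W.toFun s₂)) -
          ((y : ℂ) * (x : ℂ) ^ 2 / riemannZeta 2) * mellinW W.toFun 1 *
            VI c₂ (fun s => mellinW W.toFun (2 - s) * mellinW W.toFun s)‖ ≤
        C * (y * x ^ ((1 : ℝ) / 2 + ε)) := by
  have hT := W.isTest
  have ha : 0 < 1 / (2 * U) := by positivity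
  have hB : 0 < 1 + 1 / (2 * U) := by positivity
  set B := 1 + 1 / (2 * U)
  have hW := hT.eulerChain hB
  have hF := hT.mul_self.eulerChain_riemannError ha hB
  set δ := min ε (1 / 2)
  have hδ : 0 < δ := lt_min hε (by norm_num)
  obtain ⟨C, hC, hCx⟩ := hRH.exists_norm_tsum_moebius_le hF hδ
    ((min_le_right _ _).trans_lt (by norm_num))
  refine ⟨(‖mellinW W.toFun 1‖ + 1) * C, by positivity, 1, fun x y hx hy => ?_⟩
  have hx0 : 0 < x := by linarith
  have hmel : mellinW W.toFun = mellin (fun t => (W.toFun t : ℂ)) := funext (mellinW_eq _)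
  have hVI := hW.VI_VI (B := B) (fun t ht => by
      simp [hT.eq_zero t fun h => ht.not_ge h.2]) h1 (h12.trans h2) (h1.trans h12) h2 hx0
  have hP := hW.VI_parseval (c := c₂) (by linarith) h2
  simp only [Function.iterate_zero, id] at hVI hP
  have hfin := hT.mul_self.tsum_moebiusConvId hx0
  have hI : ∫ u in Ioi (0 : ℝ), (u : ℂ) * (W.toFun u : ℂ) ^ 2 =
      ((∫ t, t * W.toFun t ^ 2 : ℝ) : ℂ) := by
    rw [← integral_complex_ofReal, setIntegral_eq_integral_of_forall_compl_eq_zero]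
    · push_cast; rfl
    · intro u hu
      have hu : u ≤ 0 := not_lt.1 hu
      simp [hT.eq_zero u fun h => (ha.trans_le h.1).not_ge hu]
  have hmain : VI c₁ (fun s₁ => VI c₂ (fun s₂ =>
      riemannZeta (s₁ + s₂ - 1) / riemannZeta (s₁ + s₂) * (y : ℂ) * mellinW W.toFun 1 *
        (x : ℂ) ^ (s₁ + s₂) * mellinW W.toFun s₁ * mellinW W.toFun s₂)) =
      (y * mellinW W.toFun 1) * ∑' n : ℕ, moebiusConvId n * ((W.toFun (n / x) ^ 2 : ℝ) : ℂ) := by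
    push_cast
    rw [← hVI, ← VI_const_mul]
    refine VI_congr fun s₁ _ => ?_
    rw [← VI_const_mul]
    refine VI_congr fun s₂ _ => ?_
    rw [hmel]
    ring
  have hP' : VI c₂ (fun s => mellinW W.toFun (2 - s) * mellinW W.toFun s) =
      ((∫ t, t * W.toFun t ^ 2 : ℝ) : ℂ) := by rw [hmel, hP, hI]
  rw [hmain, hP', hfin]
  have hS := hCx x hx
  simp only [Function.iterate_zero, id] at hS
  set S := ∑' d : ℕ, (ArithmeticFunction.moebius d : ℂ) *
    (riemannError (fun t => W.toFun t ^ 2) (d / x) : ℂ)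
  set J : ℂ := ((∫ t, t * W.toFun t ^ 2 : ℝ) : ℂ)
  rw [show (y * mellinW W.toFun 1) * (S + (x : ℂ) ^ 2 / riemannZeta 2 * J) -
    (y * (x : ℂ) ^ 2 / riemannZeta 2) * mellinW W.toFun 1 * J = y * mellinW W.toFun 1 * S by ring,
    norm_mul, norm_mul, norm_real, Real.norm_of_nonneg (by linarith)]
  have hy0 : 0 ≤ y := by linarith
  have hpow : x ^ (1 / 2 + δ) ≤ x ^ ((1 : ℝ) / 2 + ε) :=
    Real.rpow_le_rpow_of_exponent_le hx (by linarith [min_le_left ε (1 / 2)])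
  calc y * ‖mellinW W.toFun 1‖ * ‖S‖
      ≤ y * (‖mellinW W.toFun 1‖ + 1) * (C * x ^ ((1 : ℝ) / 2 + ε)) := by
        gcongr
        · linarith
        · exact hS.trans (by gcongr)
    _ = _ := by ring
end
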